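/- arXiv:2402.09370 — 5 statements merged into one kernel-verified Lean document; each statement's English description precedes it below -/
import Mathlib

section
/- Let n, t be integers with 1 ≤ t ≤ n, let α ∈ (0, 1/2], and let y ∈ F_2^n satisfy wt(y) ≤ (1/2 − α)·n. If s is drawn uniformly at random from S_{t,n}, then the probability that the inner product ⟨s, y⟩ over F_2 equals 0 is at least 1/2 + (2α)^t/2 − t²/n. -/
open Finset
open scoped Classical

noncomputable def sgn2 (a : ZMod 2) : ℝ := if a = 0 then 1 else -1

lemma zmod2_cases (a : ZMod 2) : a = 0 ∨ a = 1 := by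
  revert a; decide

lemma sgn2_zero : sgn2 0 = 1 := by simp [sgn2]

lemma sgn2_one : sgn2 1 = -1 := by simp [sgn2]

lemma sgn2_add (a b : ZMod 2) : sgn2 (a + b) = sgn2 a * sgn2 b := by
  have h : (1 + 1 : ZMod 2) = 0 := by decide
  rcases zmod2_cases a with rfl | rfl <;> rcases zmod2_cases b with rfl | rfl <;>
    simp [sgn2_zero, sgn2_one, h]

lemma sgn2_sq (a : ZMod 2) : sgn2 a * sgn2 a = 1 := by
  rcases zmod2_cases a with rfl | rfl <;> simp [sgn2_zero, sgn2_one]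

lemma sgn2_abs (a : ZMod 2) : |sgn2 a| = 1 := by
  rcases zmod2_cases a with rfl | rfl <;> simp [sgn2_zero, sgn2_one]

lemma sgn2_sum {ι : Type*} (s : Finset ι) (f : ι → ZMod 2) :
    sgn2 (∑ i ∈ s, f i) = ∏ i ∈ s, sgn2 (f i) := by
  induction s using Finset.induction_on with
  | empty => simp [sgn2_zero]
  | insert a s ha ih => rw [sum_insert ha, prod_insert ha, sgn2_add, ih]

open Polynomial in
lemma gen_ode {ι : Type*} (s : Finset ι) (χ : ι → ℝ) (hχ : ∀ i, χ i * χ i = 1) :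
    (1 - X ^ 2) * derivative (∏ i ∈ s, (1 + C (χ i) * X)) =
      (C (∑ i ∈ s, χ i) - C (s.card : ℝ) * X) * ∏ i ∈ s, (1 + C (χ i) * X) := by
  induction s using Finset.induction_on with
  | empty => simp
  | insert a s ha ih =>
    rw [prod_insert ha, sum_insert ha, card_insert_of_notMem ha, derivative_mul]
    have h : (C (χ a) * C (χ a) : ℝ[X]) = 1 := by rw [← C_mul, hχ, C_1]
    have hd : derivative (1 + C (χ a) * X : ℝ[X]) = C (χ a) := by simp
    rw [hd]
    push_cast
    simp only [C_add, C_1]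
    generalize (∏ i ∈ s, (1 + C (χ i) * X)) = P at *
    linear_combination (1 + C (χ a) * X) * ih - (X * P) * h

/-- elementary symmetric sum -/
noncomputable def esum {ι : Type*} [Fintype ι] (χ : ι → ℝ) (t : ℕ) : ℝ :=
  ∑ S ∈ powersetCard t (univ : Finset ι), ∏ i ∈ S, χ i

open Polynomial in
lemma gen_coeff {ι : Type*} [Fintype ι] (χ : ι → ℝ) (t : ℕ) :
    (∏ i, (1 + C (χ i) * X)).coeff t = esum χ t := by
  rw [Finset.prod_one_add, finset_sum_coeff, esum]
  have h : ∀ S : Finset ι, (∏ i ∈ S, (C (χ i) * X : ℝ[X])).coeff t =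
      if S.card = t then ∏ i ∈ S, χ i else 0 := by
    intro S
    rw [prod_mul_distrib, prod_const, ← map_prod, coeff_C_mul, coeff_X_pow]
    by_cases h : S.card = t
    · simp [h]
    · simp [h, Ne.symm h]
  simp_rw [h]
  rw [← sum_filter]
  congr 1
  ext S
  simp [mem_powersetCard]

lemma esum_zero {ι : Type*} [Fintype ι] (χ : ι → ℝ) : esum χ 0 = 1 := by
  simp [esum]

lemma esum_one {ι : Type*} [Fintype ι] (χ : ι → ℝ) : esum χ 1 = ∑ i, χ i := by
  simp [esum, powersetCard_one]

open Polynomial in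
lemma esum_rec {ι : Type*} [Fintype ι] (χ : ι → ℝ) (hχ : ∀ i, χ i * χ i = 1) (t : ℕ) :
    (t + 2 : ℝ) * esum χ (t + 2) + ((Fintype.card ι : ℝ) - t) * esum χ t
      = (∑ i, χ i) * esum χ (t + 1) := by
  have h := congrArg (fun p => Polynomial.coeff p (t + 1)) (gen_ode univ χ hχ)
  have hc := gen_coeff χ
  generalize (∏ i, (1 + C (χ i) * X)) = P at *
  simp only [sub_mul, one_mul, coeff_sub, mul_assoc, coeff_C_mul, coeff_X_mul,
    coeff_derivative, hc, card_univ] at h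
  cases t with
  | zero =>
    have : (X ^ 2 * derivative P).coeff (0 + 1) = 0 := by
      rw [coeff_X_pow_mul']; simp
    rw [this] at h
    push_cast at h ⊢
    norm_num at h ⊢
    linarith
  | succ k =>
    have : (X ^ 2 * derivative P).coeff (k + 1 + 1) = esum χ (k + 1) * (k + 1) := by
      rw [coeff_X_pow_mul, coeff_derivative, hc]
    rw [this] at h
    push_cast at h ⊢
    ring_nf at h ⊢
    linarith

lemma esum_abs {ι : Type*} [Fintype ι] (χ : ι → ℝ) (hχ : ∀ i, |χ i| = 1) (t : ℕ) :
    |esum χ t| ≤ ((Fintype.card ι).choose t : ℝ) := by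
  refine (abs_sum_le_sum_abs _ _).trans ?_
  simp [abs_prod, hχ]

lemma key_bound {n : ℕ} (χ : Fin n → ℝ) (hχ : ∀ i, |χ i| = 1) (ρ : ℝ) (h0 : 0 ≤ ρ)
    (h1 : ρ ≤ 1) (hρ : ∑ i, χ i = ρ * n) (t : ℕ) (htn : t ≤ n) :
    ρ ^ t - (t : ℝ) ^ 2 / n ≤ esum χ t / (n.choose t : ℝ) := by
  have hsq : ∀ i, χ i * χ i = 1 := fun i => by
    rw [← abs_mul_abs_self, hχ]; norm_num
  induction t with
  | zero => simp [esum_zero]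
  | succ t ih =>
    have ih := ih (by omega)
    have hn : (0 : ℝ) < n := by exact_mod_cast (by omega : 0 < n)
    have hE : ∀ k, |esum χ k / (n.choose k : ℝ)| ≤ 1 := by
      intro k
      rw [abs_div, Nat.abs_cast]
      apply div_le_one_of_le₀ _ (Nat.cast_nonneg _)
      simpa using esum_abs χ hχ k
    have he : ∀ k, k ≤ n → esum χ k = (n.choose k : ℝ) * (esum χ k / (n.choose k : ℝ)) := by
      intro k hk
      have : (n.choose k : ℝ) ≠ 0 := by exact_mod_cast (Nat.choose_pos hk).ne'
      field_simp
    cases t with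
    | zero =>
      simp only [zero_add, esum_one, Nat.choose_one_right, hρ, pow_one]
      rw [mul_div_assoc, div_self hn.ne']
      have : 0 ≤ ((1 : ℕ) : ℝ) ^ 2 / (n : ℝ) := by positivity
      linarith
    | succ k =>
      have hr := esum_rec χ hsq k
      rw [Fintype.card_fin, hρ, he (k + 2) (by omega), he (k + 1) (by omega), he k (by omega)] at hr
      have c1 := Nat.choose_succ_right_eq n (k + 1)
      have c2 := Nat.choose_succ_right_eq n k
      have c1' : (n.choose (k + 2) : ℝ) * (k + 2) = n.choose (k + 1) * (n - (k + 1)) := by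
        have := congrArg (Nat.cast (R := ℝ)) c1
        rw [Nat.cast_mul, Nat.cast_mul, Nat.cast_sub (by omega)] at this
        push_cast at this
        linarith
      have c2' : (n.choose (k + 1) : ℝ) * (k + 1) = n.choose k * (n - k) := by
        have := congrArg (Nat.cast (R := ℝ)) c2
        rw [Nat.cast_mul, Nat.cast_mul, Nat.cast_sub (by omega)] at this
        push_cast at this
        linarith
      have a2 := abs_le.1 (hE (k + 2))
      have a0 := abs_le.1 (hE k)
      change _ ≤ esum χ (k + 2) / (n.choose (k + 2) : ℝ)
      have hc : (0 : ℝ) < n.choose (k + 1) := by exact_mod_cast Nat.choose_pos (by omega)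
      generalize esum χ (k + 2) / (n.choose (k + 2) : ℝ) = E2 at *
      generalize esum χ (k + 1) / (n.choose (k + 1) : ℝ) = E1 at *
      generalize esum χ k / (n.choose k : ℝ) = E0 at *
      have hr2 : (n - (k + 1) : ℝ) * E2 + (k + 1) * E0 = ρ * n * E1 := by
        apply mul_left_cancel₀ hc.ne'
        linear_combination hr - E2 * c1' + E0 * c2'
      have hk : (0 : ℝ) ≤ k := Nat.cast_nonneg k
      have step : ρ * E1 - 2 * (k + 1) / n ≤ E2 := by
        rw [sub_le_iff_le_add, ← sub_le_iff_le_add', le_div_iff₀ hn]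
        nlinarith [mul_nonneg (by linarith : (0 : ℝ) ≤ k + 1) (by linarith : 0 ≤ 2 - E0 + E2),
          mul_nonneg (by linarith : (0 : ℝ) ≤ k + 1) (by linarith : 0 ≤ 2 + E0 - E2)]
      have hq : 0 ≤ (k + 1 : ℝ) ^ 2 / n := by positivity
      have m1 := mul_le_mul_of_nonneg_left ih h0
      have m2 := mul_le_mul_of_nonneg_right h1 hq
      push_cast at m1 ⊢
      have e1 : ((k : ℝ) + 1 + 1) ^ 2 / n = (k + 1) ^ 2 / n + 2 * (k + 1) / n + 1 / n := by ring
      have e2 : 0 ≤ 1 / (n : ℝ) := by positivity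
      rw [e1, pow_succ]
      linarith

lemma sum_weight {n : ℕ} (t : ℕ) (g : Fin n → ℝ) :
    ∑ s ∈ univ.filter (fun s : Fin n → ZMod 2 => hammingNorm s = t),
      ∏ i ∈ univ.filter (fun i => s i ≠ 0), g i = esum g t := by
  rw [esum]
  refine sum_bij' (fun s _ => univ.filter (fun i => s i ≠ 0))
    (fun S _ => fun i => if i ∈ S then 1 else 0) ?_ ?_ ?_ ?_ ?_
  · intro s hs
    simpa [mem_powersetCard, hammingNorm] using hs
  · intro S hS
    simpa [mem_powersetCard, hammingNorm] using hS
  · intro s hs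
    ext i
    rcases zmod2_cases (s i) with h | h <;> simp [h]
  · intro S hS
    ext i
    simp
  · intro s hs
    rfl

lemma sgn2_inner {n : ℕ} (s y : Fin n → ZMod 2) :
    sgn2 (∑ i, s i * y i) = ∏ i ∈ univ.filter (fun i => s i ≠ 0), sgn2 (y i) := by
  rw [sgn2_sum, prod_filter]
  apply prod_congr rfl
  intro i _
  rcases zmod2_cases (s i) with h | h <;> simp [h, sgn2_zero]

/-- Let `1 ≤ t ≤ n`, `α ∈ (0, 1/2]`, and let `y ∈ F₂ⁿ` have Hamming weight
at most `(1/2 − α)·n`.  If `s` is uniform in the set `S_{t,n}` of weight-`t` vectors, then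
`Pr[⟨s, y⟩ = 0] ≥ 1/2 + (2α)^t/2 − t²/n` (the probability is written as a counting ratio). -/
theorem stmt_0 (n t : ℕ) (ht1 : 1 ≤ t) (htn : t ≤ n) (α : ℝ) (hα0 : 0 < α) (hα2 : α ≤ 1/2)
    (y : Fin n → ZMod 2) (hy : (hammingNorm y : ℝ) ≤ (1/2 - α) * n) :
    1/2 + (2*α)^t/2 - (t : ℝ)^2 / n ≤
      ((univ.filter (fun s : Fin n → ZMod 2 =>
          hammingNorm s = t ∧ ∑ i, s i * y i = 0)).card : ℝ) /
        ((univ.filter (fun s : Fin n → ZMod 2 => hammingNorm s = t)).card : ℝ) := by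
  have hn : (0 : ℝ) < n := by exact_mod_cast (by omega : 0 < n)
  have hcp : (0 : ℝ) < n.choose t := by exact_mod_cast Nat.choose_pos htn
  have hcard : ((univ.filter (fun s : Fin n → ZMod 2 => hammingNorm s = t)).card : ℝ)
      = n.choose t := by
    have := sum_weight (n := n) t (fun _ => 1)
    simpa [esum] using this
  have hnum : 2 * ((univ.filter (fun s : Fin n → ZMod 2 =>
          hammingNorm s = t ∧ ∑ i, s i * y i = 0)).card : ℝ)
      = n.choose t + esum (fun i => sgn2 (y i)) t := by
    rw [← hcard, ← sum_weight, ← filter_filter, card_filter, Nat.cast_sum, mul_sum,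
      card_eq_sum_ones, Nat.cast_sum, ← sum_add_distrib]
    apply sum_congr rfl
    intro s _
    rw [← sgn2_inner, sgn2]
    split_ifs <;> norm_num
  have hsum : ∑ i, sgn2 (y i) = n - 2 * (hammingNorm y : ℝ) := by
    have h : ∀ i, sgn2 (y i) = 1 - 2 * (if y i ≠ 0 then 1 else 0 : ℝ) := by
      intro i
      rcases zmod2_cases (y i) with h | h <;> simp [h, sgn2] <;> norm_num
    simp_rw [h]
    rw [sum_sub_distrib, ← mul_sum, hammingNorm, card_filter]
    simp
  set ρ : ℝ := 1 - 2 * (hammingNorm y : ℝ) / n with hρ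
  have hρα : 2 * α ≤ ρ := by
    have : (hammingNorm y : ℝ) / n ≤ 1/2 - α := by rwa [div_le_iff₀ hn]
    rw [hρ, mul_div_assoc]; linarith
  have hρ1 : ρ ≤ 1 := by
    have : 0 ≤ 2 * (hammingNorm y : ℝ) / n := by positivity
    linarith
  have hk := key_bound (fun i => sgn2 (y i)) (fun i => sgn2_abs _) ρ (by linarith) hρ1
    (by rw [hsum, hρ]; field_simp) t htn
  have hpow : (2 * α) ^ t ≤ ρ ^ t := pow_le_pow_left₀ (by linarith) hρα t
  have hq : 0 ≤ (t : ℝ) ^ 2 / n := by positivity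
  rw [hcard, le_div_iff₀ hcp]
  rw [le_div_iff₀ hcp] at hk
  have : (1 + (2 * α) ^ t - 2 * ((t : ℝ) ^ 2 / n)) * n.choose t
      ≤ (1 + (ρ ^ t - (t : ℝ) ^ 2 / n)) * n.choose t :=
    mul_le_mul_of_nonneg_right (by linarith) hcp.le
  linarith
end

section
/- Fix integers n, g, t with 1 ≤ t ≤ n and g ≥ 1, and let ε > 0. If G* is drawn uniformly at random from F_2^{n×g}, then Pr[ |η(G*) − C(n,t)·2^{−g}| > ε·C(n,t)·2^{−g} ] ≤ 2^g / (C(n,t)·ε²), where C(n,t) denotes the binomial coefficient n choose t. -/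
open Finset
open scoped Classical

lemma aux_card_ker {A B : Type*} [AddCommGroup A] [AddCommGroup B] [Fintype A] [Fintype B]
    (f : A →+ B) (hf : Function.Surjective f) :
    (univ.filter (fun a => f a = 0)).card * Fintype.card B = Fintype.card A := by
  have h := f.ker.card_mul_index
  rw [AddSubgroup.index_ker, AddMonoidHom.range_eq_top.mpr hf] at h
  rw [← Nat.card_eq_fintype_card (α := A), ← h, AddSubgroup.card_top, Nat.card_eq_fintype_card (α := B)]
  congr 1
  rw [Nat.card_eq_fintype_card, ← Fintype.card_subtype]
  exact Fintype.card_congr (Equiv.refl _)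

lemma aux_card_weight (n t : ℕ) :
    (univ.filter (fun w : Fin n → ZMod 2 => hammingNorm w = t)).card = n.choose t := by
  have h : (powersetCard t (univ : Finset (Fin n))).card = n.choose t := by simp
  rw [← h]
  have hz : ∀ x : ZMod 2, x ≠ 0 → x = 1 := by decide
  refine Finset.card_bij' (fun w _ => univ.filter (fun i => w i ≠ 0))
    (fun s _ => fun i => if i ∈ s then 1 else 0) ?_ ?_ ?_ ?_
  · intro w hw
    simp only [mem_filter, mem_univ, true_and] at hw
    simp only [mem_powersetCard, subset_univ, true_and]
    rw [← hw, hammingNorm]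
  · intro s hs
    simp only [mem_powersetCard, subset_univ, true_and] at hs
    simp only [mem_filter, mem_univ, true_and]
    rw [← hs, hammingNorm]
    congr 1
    ext i
    simp
  · intro w hw
    ext i
    by_cases h : w i = 0
    · simp [h]
    · simp [h, hz _ h]
  · intro s hs
    ext i
    simp

lemma aux_single {n g : ℕ} (w : Fin n → ZMod 2) (hw : w ≠ 0) :
    (univ.filter (fun G : Matrix (Fin n) (Fin g) (ZMod 2) => Matrix.vecMul w G = 0)).card * 2 ^ g
      = Fintype.card (Matrix (Fin n) (Fin g) (ZMod 2)) := by
  let f : Matrix (Fin n) (Fin g) (ZMod 2) →+ (Fin g → ZMod 2) :=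
    { toFun := fun G => Matrix.vecMul w G
      map_zero' := Matrix.vecMul_zero w
      map_add' := fun A B => Matrix.vecMul_add A B w }
  have hz : ∀ x : ZMod 2, x ≠ 0 → x = 1 := by decide
  have hf : Function.Surjective f := by
    obtain ⟨i, hi⟩ := Function.ne_iff.mp hw
    intro y
    refine ⟨Matrix.vecMulVec (Pi.single i 1) y, ?_⟩
    change Matrix.vecMul w _ = y
    rw [Matrix.vecMul_vecMulVec]
    simp [hz _ hi]
  have := aux_card_ker f hf
  have hc : Fintype.card (Fin g → ZMod 2) = 2 ^ g := by simp [ZMod.card]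
  rw [hc] at this
  rw [← this]
  congr 2
  ext G
  simp [f]

lemma aux_vec {n : ℕ} (w v : Fin n → ZMod 2) (hw : w ≠ 0) (hv : v ≠ 0) (hwv : w ≠ v) :
    ∃ x : Fin n → ZMod 2, w ⬝ᵥ x = 1 ∧ v ⬝ᵥ x = 0 := by
  have hz : ∀ x : ZMod 2, x ≠ 0 → x = 1 := by decide
  by_cases h : ∃ i, w i ≠ 0 ∧ v i = 0
  · obtain ⟨i, h1, h2⟩ := h
    exact ⟨Pi.single i 1, by simp [hz _ h1], by simp [h2]⟩
  · push Not at h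
    obtain ⟨i, hi⟩ := Function.ne_iff.mp hwv
    obtain ⟨j, hj⟩ := Function.ne_iff.mp hw
    have hj1 := hz _ hj
    have hj2 := hz _ (h j hj)
    have hwi : w i = 0 := by
      by_contra hc
      exact hi (by rw [hz _ hc, hz _ (h i hc)])
    have hvi : v i = 1 := hz _ (fun hc => hi (by rw [hwi, hc]))
    refine ⟨Pi.single i 1 + Pi.single j 1, ?_, ?_⟩
    · simp [dotProduct_add, hwi, hj1]
    · simp [dotProduct_add, hvi, hj2]
      decide

lemma aux_pair {n g : ℕ} (w v : Fin n → ZMod 2) (hw : w ≠ 0) (hv : v ≠ 0) (hwv : w ≠ v) :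
    (univ.filter (fun G : Matrix (Fin n) (Fin g) (ZMod 2) =>
      Matrix.vecMul w G = 0 ∧ Matrix.vecMul v G = 0)).card * (2 ^ g * 2 ^ g)
      = Fintype.card (Matrix (Fin n) (Fin g) (ZMod 2)) := by
  let f : Matrix (Fin n) (Fin g) (ZMod 2) →+ (Fin g → ZMod 2) × (Fin g → ZMod 2) :=
    { toFun := fun G => (Matrix.vecMul w G, Matrix.vecMul v G)
      map_zero' := by simp
      map_add' := fun A B => by simp [Matrix.vecMul_add] }
  have hf : Function.Surjective f := by
    obtain ⟨x, hx1, hx2⟩ := aux_vec w v hw hv hwv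
    obtain ⟨y, hy1, hy2⟩ := aux_vec v w hv hw hwv.symm
    rintro ⟨a, b⟩
    refine ⟨Matrix.vecMulVec x a + Matrix.vecMulVec y b, ?_⟩
    change (Matrix.vecMul w _, Matrix.vecMul v _) = (a, b)
    simp [Matrix.vecMul_add, Matrix.vecMul_vecMulVec, hx1, hx2, hy1, hy2]
  have := aux_card_ker f hf
  rw [← this]
  congr 1
  · congr 1
    ext G
    simp [f, Prod.ext_iff]
  · simp [ZMod.card]

lemma aux_main (n g t : ℕ) (ht1 : 1 ≤ t) :
    ∑ G : Matrix (Fin n) (Fin g) (ZMod 2),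
      (((univ.filter (fun w : Fin n → ZMod 2 =>
              hammingNorm w = t ∧ Matrix.vecMul w G = 0)).card : ℝ) -
            (n.choose t : ℝ) / 2 ^ g) ^ 2 ≤
      (Fintype.card (Matrix (Fin n) (Fin g) (ZMod 2)) : ℝ) * ((n.choose t : ℝ) / 2 ^ g) := by
  set N : ℝ := (Fintype.card (Matrix (Fin n) (Fin g) (ZMod 2)) : ℝ) with hN
  set S := univ.filter (fun w : Fin n → ZMod 2 => hammingNorm w = t) with hS
  have hScard : (S.card : ℝ) = n.choose t := by rw [hS, aux_card_weight]
  have hS0 : ∀ w ∈ S, w ≠ 0 := by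
    rintro w hw rfl
    simp [hS] at hw
    omega
  have hN0 : 0 ≤ N := by positivity
  have hp : (0 : ℝ) < 2 ^ g := by positivity
  let I : (Fin n → ZMod 2) → Matrix (Fin n) (Fin g) (ZMod 2) → ℝ :=
    fun w G => if Matrix.vecMul w G = 0 then 1 else 0
  have heta : ∀ G : Matrix (Fin n) (Fin g) (ZMod 2), ((univ.filter (fun w : Fin n → ZMod 2 =>
      hammingNorm w = t ∧ Matrix.vecMul w G = 0)).card : ℝ) = ∑ w ∈ S, I w G := by
    intro G
    simp only [I, Finset.sum_boole, hS, Finset.filter_filter]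
  have h1 : ∀ w ∈ S, ∑ G, I w G = N / 2 ^ g := by
    intro w hw
    have h := aux_single (g := g) w (hS0 w hw)
    rw [eq_div_iff hp.ne', hN, ← h]
    simp only [I, Finset.sum_boole]
    push_cast
    rfl
  have h2 : ∀ w ∈ S, ∀ v ∈ S, ∑ G, I w G * I v G ≤
      N / (2 ^ g * 2 ^ g) + if w = v then N / 2 ^ g else 0 := by
    intro w hw v hv
    by_cases hwv : w = v
    · subst hwv
      have : ∑ G, I w G * I w G = ∑ G, I w G := by
        refine Finset.sum_congr rfl fun G _ => ?_
        simp [I]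
      rw [this, h1 w hw]
      simp
      positivity
    · have h := aux_pair (g := g) w v (hS0 w hw) (hS0 v hv) hwv
      simp only [hwv, if_false, add_zero]
      apply le_of_eq
      rw [eq_div_iff (by positivity), hN, ← h]
      have : ∀ G, I w G * I v G =
        if Matrix.vecMul w G = 0 ∧ Matrix.vecMul v G = 0 then 1 else 0 := by
        intro G
        simp only [I]
        by_cases ha : Matrix.vecMul w G = 0 <;> by_cases hb : Matrix.vecMul v G = 0 <;>
          simp [ha, hb]
      simp only [this, Finset.sum_boole]
      push_cast
      rfl
  have e1 : ∑ G, ∑ w ∈ S, I w G = N * ((n.choose t : ℝ) / 2 ^ g) := by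
    rw [Finset.sum_comm, Finset.sum_congr rfl h1, Finset.sum_const, nsmul_eq_mul, hScard]
    ring
  have e2 : ∑ G, (∑ w ∈ S, I w G) ^ 2 ≤
      N * ((n.choose t : ℝ) / 2 ^ g) ^ 2 + N * ((n.choose t : ℝ) / 2 ^ g) := by
    have : ∑ G, (∑ w ∈ S, I w G) ^ 2 = ∑ w ∈ S, ∑ v ∈ S, ∑ G, I w G * I v G := by
      simp only [sq, Finset.sum_mul_sum]
      rw [Finset.sum_comm]
      refine Finset.sum_congr rfl fun w _ => ?_
      rw [Finset.sum_comm]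
    rw [this]
    refine (Finset.sum_le_sum fun w hw => Finset.sum_le_sum fun v hv => h2 w hw v hv).trans ?_
    apply le_of_eq
    have : ∀ w ∈ S, ∑ v ∈ S, (N / (2 ^ g * 2 ^ g) + if w = v then N / 2 ^ g else 0) =
        (n.choose t : ℝ) * (N / (2 ^ g * 2 ^ g)) + N / 2 ^ g := by
      intro w hw
      rw [Finset.sum_add_distrib, Finset.sum_const, nsmul_eq_mul, hScard, Finset.sum_ite_eq,
        if_pos hw]
    rw [Finset.sum_congr rfl this, Finset.sum_const, nsmul_eq_mul, hScard]
    field_simp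
  simp only [heta]
  set μ := (n.choose t : ℝ) / 2 ^ g
  have : ∑ G, ((∑ w ∈ S, I w G) - μ) ^ 2 =
      ∑ G, (∑ w ∈ S, I w G) ^ 2 - 2 * μ * ∑ G, ∑ w ∈ S, I w G + N * μ ^ 2 := by
    simp only [sub_sq, Finset.sum_add_distrib, Finset.sum_sub_distrib, Finset.sum_const,
      nsmul_eq_mul, Finset.card_univ, Finset.mul_sum]
    congr 2
    refine Finset.sum_congr rfl fun G _ => ?_
    rw [Finset.sum_mul]
    exact Finset.sum_congr rfl fun w _ => by ring
  rw [this, e1]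
  nlinarith

/-- Fix `1 ≤ t ≤ n` and `g ≥ 1`, and `ε > 0`.  For a uniformly random
`G* ∈ F₂^{n×g}`, letting `η(G*)` be the number of weight-`t` vectors `w` with `wᵀ·G* = 0`,
we have `Pr[|η(G*) − C(n,t)·2^{−g}| > ε·C(n,t)·2^{−g}] ≤ 2^g/(C(n,t)·ε²)`. -/
theorem stmt_5 (n g t : ℕ) (ht1 : 1 ≤ t) (htn : t ≤ n) (hg : 1 ≤ g) (ε : ℝ) (hε : 0 < ε) :
    ((univ.filter (fun G : Matrix (Fin n) (Fin g) (ZMod 2) =>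
        ε * ((n.choose t : ℝ) / 2 ^ g) <
          |(((univ.filter (fun w : Fin n → ZMod 2 =>
              hammingNorm w = t ∧ Matrix.vecMul w G = 0)).card : ℝ)) -
            (n.choose t : ℝ) / 2 ^ g|)).card : ℝ) /
      (Fintype.card (Matrix (Fin n) (Fin g) (ZMod 2)) : ℝ)
    ≤ (2 : ℝ) ^ g / ((n.choose t : ℝ) * ε ^ 2) := by
  have hmain := aux_main n g t ht1
  set μ := (n.choose t : ℝ) / 2 ^ g with hμ
  have hC : (0 : ℝ) < n.choose t := by exact_mod_cast Nat.choose_pos htn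
  have hp : (0 : ℝ) < 2 ^ g := by positivity
  have hμ0 : 0 < μ := by positivity
  have hN : (0 : ℝ) < Fintype.card (Matrix (Fin n) (Fin g) (ZMod 2)) := by
    exact_mod_cast Fintype.card_pos
  set η : Matrix (Fin n) (Fin g) (ZMod 2) → ℝ := fun G =>
    ((univ.filter (fun w : Fin n → ZMod 2 =>
              hammingNorm w = t ∧ Matrix.vecMul w G = 0)).card : ℝ) with hη
  set N : ℝ := (Fintype.card (Matrix (Fin n) (Fin g) (ZMod 2)) : ℝ)
  change ((univ.filter (fun G => ε * μ < |η G - μ|)).card : ℝ) / N ≤ _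
  change ∑ G, (η G - μ) ^ 2 ≤ N * μ at hmain
  set B := univ.filter (fun G => ε * μ < |η G - μ|) with hB
  have hcheb : (B.card : ℝ) * (ε * μ) ^ 2 ≤ N * μ := by
    calc (B.card : ℝ) * (ε * μ) ^ 2 = ∑ G ∈ B, (ε * μ) ^ 2 := by simp
      _ ≤ ∑ G ∈ B, (η G - μ) ^ 2 := by
        refine Finset.sum_le_sum fun G hG => ?_
        have h := (Finset.mem_filter.mp hG).2
        rw [← sq_abs (η G - μ)]
        exact pow_le_pow_left₀ (by positivity) h.le 2
      _ ≤ ∑ G, (η G - μ) ^ 2 :=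
        Finset.sum_le_sum_of_subset_of_nonneg (Finset.subset_univ _) fun _ _ _ => sq_nonneg _
      _ ≤ N * μ := hmain
  have hr : (2 : ℝ) ^ g / ((n.choose t : ℝ) * ε ^ 2) = 1 / (μ * ε ^ 2) := by
    rw [hμ]
    field_simp
  rw [hr, div_le_div_iff₀ hN (by positivity)]
  have : (B.card * (μ * ε ^ 2)) * μ ≤ (1 * N) * μ := by
    linarith [hcheb, (by ring : (B.card * (μ * ε ^ 2)) * μ = (B.card : ℝ) * (ε * μ) ^ 2)]
  exact le_of_mul_le_mul_right this hμ0
end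

section
/- Fix a constant C > 0, and let r, t : ℕ → ℕ satisfy r(n) ≤ 0.99·n, t(n)/√(log n) → ∞, and t(n) ≤ C·log n. Then there exist a constant β > 0 and a function g : ℕ → ℕ with g(n) ≥ β·t(n)² such that the statistical distance between the marginal distribution of G under (P, G) ← LDPC[n, g(n), t(n), r(n)] and the uniform distribution on F_2^{n×g(n)} is negligible in n. -/
open Finset Filter
open scoped Classical

noncomputable section

/-- `ν : ℕ → ℝ` is negligible if for every `k`, `ν n ≤ n⁻ᵏ` for all sufficiently large `n`. -/
def Negligible (ν : ℕ → ℝ) : Prop :=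
  ∀ k : ℕ, ∃ N : ℕ, ∀ n ≥ N, ν n ≤ 1 / (n : ℝ) ^ k

/-- The set `S_{t,r,n}` of `r × n` matrices over `F₂` each of whose rows has Hamming weight
exactly `t`. -/
def sparseRows (t r n : ℕ) : Finset (Matrix (Fin r) (Fin n) (ZMod 2)) :=
  univ.filter (fun P => ∀ i, hammingNorm (P i) = t)

/-- The set of `n × g` matrices `G` over `F₂` with `P·G = 0` (columns in `ker P`). -/
def kerMats (n g : ℕ) {r : ℕ} (P : Matrix (Fin r) (Fin n) (ZMod 2)) :
    Finset (Matrix (Fin n) (Fin g) (ZMod 2)) :=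
  univ.filter (fun G => P * G = 0)

/-- The marginal probability mass of the generator matrix `G₀` under `LDPC[n,g,t,r]`:
sample `P` uniformly from `S_{t,r,n}`, then `G` uniformly among the matrices with
`P·G = 0` (i.e. columns independent and uniform in `ker P`). -/
def margMass (n g t r : ℕ) (G₀ : Matrix (Fin n) (Fin g) (ZMod 2)) : ℝ :=
  (1 / ((sparseRows t r n).card : ℝ)) *
    ∑ P ∈ sparseRows t r n,
      (if P * G₀ = 0 then (1 / ((kerMats n g P).card : ℝ)) else 0)

/-- sign character of `ZMod 2` -/
def sg (a : ZMod 2) : ℝ := if a = 0 then 1 else -1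

lemma sg_add (a b : ZMod 2) : sg (a + b) = sg a * sg b := by
  have h : ∀ a : ZMod 2, a = 0 ∨ a = 1 := by decide
  have h1 : (1 : ZMod 2) + 1 = 0 := by decide
  rcases h a with rfl | rfl <;> rcases h b with rfl | rfl <;> simp [sg, h1]

lemma sg_zero : sg 0 = 1 := by simp [sg]
lemma sg_ne {a : ZMod 2} (h : a ≠ 0) : sg a = -1 := by simp [sg, h]

lemma sg_sq (a : ZMod 2) : sg a * sg a = 1 := by
  unfold sg; split_ifs <;> norm_num

lemma sg_abs (a : ZMod 2) : |sg a| = 1 := by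
  unfold sg; split_ifs <;> norm_num

/-- kernel of the rows of `P`, as a finset -/
def kerF {n r : ℕ} (P : Fin r → Fin n → ZMod 2) : Finset (Fin n → ZMod 2) :=
  univ.filter (fun v => ∀ i, P i ⬝ᵥ v = 0)

lemma mem_kerF {n r : ℕ} (P : Fin r → Fin n → ZMod 2) (v) :
    v ∈ kerF P ↔ ∀ i, P i ⬝ᵥ v = 0 := by simp [kerF]

lemma kerF_add {n r : ℕ} (P : Fin r → Fin n → ZMod 2) {u v} (hu : u ∈ kerF P)
    (hv : v ∈ kerF P) : u + v ∈ kerF P := by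
  rw [mem_kerF] at *
  intro i
  rw [dotProduct_add, hu i, hv i, add_zero]

lemma kerF_pos {n r : ℕ} (P : Fin r → Fin n → ZMod 2) : 0 < (kerF P).card := by
  apply Finset.card_pos.2
  exact ⟨0, by simp [mem_kerF]⟩

lemma mem_kerF_cons {n r : ℕ} (P : Fin r → Fin n → ZMod 2) (p v) :
    v ∈ kerF (Fin.cons p P : Fin (r+1) → Fin n → ZMod 2) ↔ p ⬝ᵥ v = 0 ∧ v ∈ kerF P := by
  simp [mem_kerF, Fin.forall_fin_succ]

lemma zmod2_dbl {n : ℕ} (u v : Fin n → ZMod 2) : u + v + v = u := by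
  have h1 : ∀ a b : ZMod 2, a + b + b = a := by decide
  ext i; exact h1 _ _

lemma zmod2_ne {a : ZMod 2} (h : a ≠ 0) : a = 1 := by
  revert h; revert a; decide

/-- translation: exact halving -/
lemma kerF_half {n r : ℕ} (P : Fin r → Fin n → ZMod 2) (p v) (hv : v ∈ kerF P)
    (hp : p ⬝ᵥ v ≠ 0) : (kerF P).card = 2 * (kerF (Fin.cons p P : Fin (r+1) → Fin n → ZMod 2)).card := by
  have h11 : (1 : ZMod 2) + 1 = 0 := by decide
  have hs := Finset.card_filter_add_card_filter_not (s := kerF P) (fun u => p ⬝ᵥ u = 0)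
  have h1 : (kerF P).filter (fun u => p ⬝ᵥ u = 0)
      = kerF (Fin.cons p P : Fin (r+1) → Fin n → ZMod 2) := by
    ext u; rw [mem_kerF_cons, mem_filter, and_comm]
  have h2 : ((kerF P).filter (fun u => ¬ p ⬝ᵥ u = 0)).card
      = ((kerF P).filter (fun u => p ⬝ᵥ u = 0)).card := by
    apply Finset.card_nbij' (fun u => u + v) (fun u => u + v)
    · intro u hu
      simp only [coe_filter, Set.mem_ofPred_eq] at hu ⊢
      refine ⟨kerF_add P hu.1 hv, ?_⟩
      rw [dotProduct_add, zmod2_ne hp, zmod2_ne hu.2, h11]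
    · intro u hu
      simp only [coe_filter, Set.mem_ofPred_eq] at hu ⊢
      refine ⟨kerF_add P hu.1 hv, ?_⟩
      rw [dotProduct_add, zmod2_ne hp, hu.2]; decide
    · intro u _; exact zmod2_dbl u v
    · intro u _; exact zmod2_dbl u v
  rw [h2, h1] at hs
  omega

lemma kerF_cons_le {n r : ℕ} (P : Fin r → Fin n → ZMod 2) (p) :
    (kerF (Fin.cons p P : Fin (r+1) → Fin n → ZMod 2)).card ≤ (kerF P).card := by
  apply Finset.card_le_card
  intro v hv
  exact ((mem_kerF_cons P p v).1 hv).2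

lemma kerF_cons_eq {n r : ℕ} (P : Fin r → Fin n → ZMod 2) (p)
    (h : ∀ v ∈ kerF P, p ⬝ᵥ v = 0) :
    kerF (Fin.cons p P : Fin (r+1) → Fin n → ZMod 2) = kerF P := by
  ext v
  rw [mem_kerF_cons]
  exact ⟨fun h => h.2, fun h' => ⟨h v h', h'⟩⟩

lemma kerF_le_two {n r : ℕ} (P : Fin r → Fin n → ZMod 2) (p) :
    (kerF P).card ≤ 2 * (kerF (Fin.cons p P : Fin (r+1) → Fin n → ZMod 2)).card := by
  by_cases h : ∀ v ∈ kerF P, p ⬝ᵥ v = 0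
  · rw [kerF_cons_eq P p h]; omega
  · push Not at h
    obtain ⟨v, hv, hp⟩ := h
    exact (kerF_half P p v hv hp).le

lemma kerF_ge {n : ℕ} : ∀ {r : ℕ} (P : Fin r → Fin n → ZMod 2), 2 ^ n ≤ 2 ^ r * (kerF P).card := by
  intro r
  induction r with
  | zero =>
    intro P
    have : kerF P = univ := by ext v; simp [mem_kerF]
    rw [this, card_univ]; simp [ZMod.card]
  | succ r ih =>
    intro P
    have := kerF_le_two (Fin.tail P) (P 0)
    rw [Fin.cons_self_tail] at this
    have h2 := ih (Fin.tail P)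
    rw [pow_succ]
    nlinarith [pow_pos (two_pos : (0:ℕ) < 2) r]

/-- good pair: product structure -/
lemma kerF_good {n r : ℕ} (P : Fin r → Fin n → ZMod 2) (p q)
    (h : ¬ ∀ v ∈ kerF P, (p + q) ⬝ᵥ v = 0) :
    (kerF P).card * (kerF (Fin.cons p (Fin.cons q P : Fin (r+1) → Fin n → ZMod 2) :
      Fin (r+2) → Fin n → ZMod 2)).card
    = (kerF (Fin.cons p P : Fin (r+1) → Fin n → ZMod 2)).card *
      (kerF (Fin.cons q P : Fin (r+1) → Fin n → ZMod 2)).card := by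
  push Not at h
  obtain ⟨v, hv, hpq⟩ := h
  rw [add_dotProduct] at hpq
  by_cases hp : p ⬝ᵥ v = 0
  · have hq : q ⬝ᵥ v ≠ 0 := by intro hq; apply hpq; rw [hp, hq, add_zero]
    have h1 := kerF_half P q v hv hq
    have h2 := kerF_half (Fin.cons p P : Fin (r+1) → Fin n → ZMod 2) q v
      ((mem_kerF_cons _ _ _).2 ⟨hp, hv⟩) hq
    have h3 : kerF (Fin.cons p (Fin.cons q P : Fin (r+1) → Fin n → ZMod 2) :
      Fin (r+2) → Fin n → ZMod 2) = kerF (Fin.cons q (Fin.cons p P : Fin (r+1) → Fin n → ZMod 2) :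
      Fin (r+2) → Fin n → ZMod 2) := by
      ext u; simp only [mem_kerF_cons]; tauto
    rw [h3, h1, h2]; ring
  · by_cases hq : q ⬝ᵥ v = 0
    · have h1 := kerF_half P p v hv hp
      have h2 := kerF_half (Fin.cons q P : Fin (r+1) → Fin n → ZMod 2) p v
        ((mem_kerF_cons _ _ _).2 ⟨hq, hv⟩) hp
      rw [h1, h2]; ring
    · exfalso; apply hpq; rw [zmod2_ne hp, zmod2_ne hq]; decide

lemma kerF_bad {n r : ℕ} (P : Fin r → Fin n → ZMod 2) (p q) :
    (kerF P).card * (kerF (Fin.cons p (Fin.cons q P : Fin (r+1) → Fin n → ZMod 2) :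
      Fin (r+2) → Fin n → ZMod 2)).card
    ≤ 2 * ((kerF (Fin.cons p P : Fin (r+1) → Fin n → ZMod 2)).card *
      (kerF (Fin.cons q P : Fin (r+1) → Fin n → ZMod 2)).card) := by
  have h1 := kerF_le_two P p
  have h2 := kerF_cons_le (Fin.cons q P : Fin (r+1) → Fin n → ZMod 2) p
  calc _ ≤ (2 * (kerF (Fin.cons p P : Fin (r+1) → Fin n → ZMod 2)).card) *
      (kerF (Fin.cons q P : Fin (r+1) → Fin n → ZMod 2)).card := Nat.mul_le_mul h1 h2
    _ = _ := by ring

lemma mem_kerMats {n g r : ℕ} (P : Matrix (Fin r) (Fin n) (ZMod 2)) (G) :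
    G ∈ kerMats n g P ↔ ∀ j, (fun i => G i j) ∈ kerF P := by
  simp only [kerMats, mem_filter, mem_univ, true_and]
  constructor
  · intro h j
    refine (mem_kerF P _).2 fun i => ?_
    have := congrFun (congrFun h i) j
    simpa [Matrix.mul_apply, dotProduct] using this
  · intro h
    ext i j
    have := (mem_kerF P _).1 (h j) i
    simpa [Matrix.mul_apply, dotProduct] using this

lemma card_kerMats {n g r : ℕ} (P : Matrix (Fin r) (Fin n) (ZMod 2)) :
    (kerMats n g P).card = (kerF P).card ^ g := by
  have : (Fintype.piFinset (fun _ : Fin g => kerF P)).card = (kerF P).card ^ g := by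
    simp
  rw [← this]
  apply Finset.card_nbij' (fun G j i => G i j) (fun H i j => H j i)
  · intro G hG
    have := (mem_kerMats P G).1 (by simpa using hG)
    simpa using this
  · intro H hH
    have : ∀ j, H j ∈ kerF P := by simpa using hH
    exact (mem_kerMats P _).2 this
  · intro G _; rfl
  · intro G _; rfl

lemma charsum_zero {n r : ℕ} (P : Fin r → Fin n → ZMod 2) (p)
    (h : ¬ ∀ v ∈ kerF P, p ⬝ᵥ v = 0) : ∑ v ∈ kerF P, sg (p ⬝ᵥ v) = 0 := by
  push Not at h
  obtain ⟨v, hv, hp⟩ := h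
  have : ∑ u ∈ kerF P, sg (p ⬝ᵥ u) = ∑ u ∈ kerF P, sg (p ⬝ᵥ (u + v)) := by
    symm
    apply Finset.sum_nbij' (fun u => u + v) (fun u => u + v)
    · intro u hu; exact kerF_add P hu hv
    · intro u hu; exact kerF_add P hu hv
    · intro u _; exact zmod2_dbl u v
    · intro u _; exact zmod2_dbl u v
    · intro u _; rfl
  have h2 : ∑ u ∈ kerF P, sg (p ⬝ᵥ (u + v)) = - ∑ u ∈ kerF P, sg (p ⬝ᵥ u) := by
    rw [← Finset.sum_neg_distrib]
    apply Finset.sum_congr rfl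
    intro u _
    rw [dotProduct_add, sg_add, sg_ne hp]; ring
  linarith

/-- indicator of badness dominated by a character sum -/
lemma bad_le {n r : ℕ} (P : Fin r → Fin n → ZMod 2) (p q) :
    (if ∀ v ∈ kerF P, (p + q) ⬝ᵥ v = 0 then (1:ℝ) else 0) ≤
      (1 / 2 ^ n) * ∑ χ : Fin n → ZMod 2, sg (p ⬝ᵥ χ) * sg (q ⬝ᵥ χ) * ∏ i, (1 + sg (P i ⬝ᵥ χ)) := by
  have h1 : ∀ χ : Fin n → ZMod 2, sg (p ⬝ᵥ χ) * sg (q ⬝ᵥ χ) * ∏ i, (1 + sg (P i ⬝ᵥ χ))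
      = if χ ∈ kerF P then 2 ^ r * sg ((p + q) ⬝ᵥ χ) else 0 := by
    intro χ
    rw [add_dotProduct, sg_add]
    split_ifs with h
    · have : ∏ i, (1 + sg (P i ⬝ᵥ χ)) = 2 ^ r := by
        rw [Finset.prod_congr rfl (g := fun _ => (2:ℝ))]
        · simp
        · intro i _
          rw [(mem_kerF P χ).1 h i, sg_zero]; norm_num
      rw [this]; ring
    · rw [mem_kerF] at h
      push Not at h
      obtain ⟨i, hi⟩ := h
      rw [Finset.prod_eq_zero (mem_univ i), mul_zero]
      rw [sg_ne hi]; norm_num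
  simp_rw [h1]
  rw [← Finset.sum_filter, ← Finset.mul_sum]
  have h3 : (univ.filter (fun χ => χ ∈ kerF P)) = kerF P := by ext; simp
  rw [h3]
  split_ifs with h
  · rw [Finset.sum_congr rfl (g := fun _ => (1:ℝ))]
    · have := kerF_ge P
      have h4 : (2:ℝ) ^ n ≤ 2 ^ r * (kerF P).card := by exact_mod_cast this
      rw [Finset.sum_const, nsmul_eq_mul, mul_one, one_div, inv_mul_eq_div, le_div_iff₀ (by positivity)]
      linarith
    · intro v hv; rw [h v hv, sg_zero]
  · rw [charsum_zero P _ h]; simp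

/-- generic second-moment step -/
lemma step_gen {α ι : Type*} [Fintype α] [DecidableEq α] (A : Finset α) (B : ι → Finset α) (S : Finset ι)
    (hS : S.Nonempty) (hB : ∀ p ∈ S, B p ⊆ A) (hB0 : ∀ p ∈ S, 0 < (B p).card) :
    (∑ x, |(1 / (S.card : ℝ)) * ∑ p ∈ S, (if x ∈ B p then 1 / ((B p).card : ℝ) else 0)
      - (if x ∈ A then 1 / (A.card : ℝ) else 0)|) ^ 2 ≤
    (1 / (S.card : ℝ)) ^ 2 * (∑ p ∈ S, ∑ q ∈ S,
      (A.card * (B p ∩ B q).card : ℝ) / ((B p).card * (B q).card)) - 1 := by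
  obtain ⟨p0, hp0⟩ := hS
  have hs : (0:ℝ) < S.card := by exact_mod_cast Finset.card_pos.2 ⟨p0, hp0⟩
  have hA : (0:ℝ) < A.card := by
    exact_mod_cast (hB0 p0 hp0).trans_le (Finset.card_le_card (hB p0 hp0))
  set f : α → ℝ := fun x => (1 / (S.card : ℝ)) * ∑ p ∈ S, (if x ∈ B p then 1 / ((B p).card : ℝ) else 0) with hf
  have hfA : ∀ x ∉ A, f x = 0 := by
    intro x hx
    simp only [hf]
    rw [Finset.sum_eq_zero, mul_zero]
    intro p hp
    rw [if_neg (fun h => hx (hB p hp h))]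
  have h1 : ∑ x, |f x - (if x ∈ A then 1 / (A.card : ℝ) else 0)| = ∑ x ∈ A, |f x - 1 / A.card| := by
    symm
    rw [Finset.sum_congr rfl (g := fun x => |f x - (if x ∈ A then 1 / (A.card : ℝ) else 0)|)]
    · apply Finset.sum_subset (subset_univ A)
      intro x _ hx
      rw [hfA x hx, if_neg hx]; simp
    · intro x hx; rw [if_pos hx]
  have h2 : (∑ x ∈ A, |f x - 1 / A.card|) ^ 2 ≤ A.card * ∑ x ∈ A, (f x - 1 / A.card) ^ 2 := by
    have := sq_sum_le_card_mul_sum_sq (s := A) (f := fun x => |f x - 1 / A.card|)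
    simpa only [sq_abs] using this
  have hsumf : ∑ x ∈ A, f x = 1 := by
    simp only [hf]
    rw [← Finset.mul_sum, Finset.sum_comm]
    rw [Finset.sum_congr rfl (g := fun _ => (1:ℝ))]
    · simp; field_simp
    · intro p hp
      rw [← Finset.sum_filter, Finset.filter_mem_eq_inter, Finset.inter_eq_right.2 (hB p hp)]
      have : (0:ℝ) < (B p).card := by exact_mod_cast hB0 p hp
      simp; field_simp
  have hsumf2 : ∑ x ∈ A, f x ^ 2 = (1 / (S.card : ℝ)) ^ 2 * (∑ p ∈ S, ∑ q ∈ S,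
      ((B p ∩ B q).card : ℝ) / ((B p).card * (B q).card)) := by
    simp only [hf, mul_pow]
    rw [← Finset.mul_sum]
    congr 1
    simp_rw [sq, Finset.sum_mul_sum]
    rw [Finset.sum_comm]
    apply Finset.sum_congr rfl
    intro p hp
    rw [Finset.sum_comm]
    apply Finset.sum_congr rfl
    intro q hq
    have : ∀ x, ((if x ∈ B p then 1 / ((B p).card : ℝ) else 0) * if x ∈ B q then 1 / ((B q).card : ℝ) else 0)
      = if x ∈ B p ∩ B q then 1 / ((B p).card * (B q).card : ℝ) else 0 := by
      intro x
      by_cases h1 : x ∈ B p <;> by_cases h2 : x ∈ B q <;> simp [h1, h2, mul_comm]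
    simp_rw [this]
    rw [← Finset.sum_filter, Finset.filter_mem_eq_inter, Finset.inter_eq_right.2
      (Finset.inter_subset_left.trans (hB p hp))]
    simp [div_eq_mul_inv]
  have h3 : A.card * ∑ x ∈ A, (f x - 1 / A.card) ^ 2 = A.card * (∑ x ∈ A, f x ^ 2) - 1 := by
    have : ∀ x, (f x - 1 / A.card) ^ 2 = f x ^ 2 - 2 / A.card * f x + 1 / A.card ^ 2 := by
      intro x; field_simp; ring
    simp_rw [this]
    rw [Finset.sum_add_distrib, Finset.sum_sub_distrib, ← Finset.mul_sum, hsumf]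
    simp
    field_simp
    ring
  rw [h1]
  refine h2.trans ?_
  rw [h3, hsumf2, ← mul_assoc, mul_comm (A.card : ℝ), mul_assoc, Finset.mul_sum]
  apply le_of_eq
  congr 2
  apply Finset.sum_congr rfl
  intro p _
  rw [Finset.mul_sum]
  apply Finset.sum_congr rfl
  intro q _
  ring
/-- weight-`t` vectors -/
def wtS (t n : ℕ) : Finset (Fin n → ZMod 2) := univ.filter (fun p => hammingNorm p = t)

lemma mem_wtS {t n : ℕ} {p : Fin n → ZMod 2} : p ∈ wtS t n ↔ hammingNorm p = t := by
  simp [wtS]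

def rowsF (t r n : ℕ) : Finset (Fin r → Fin n → ZMod 2) := Fintype.piFinset (fun _ => wtS t n)

lemma mem_rowsF {t r n : ℕ} {P : Fin r → Fin n → ZMod 2} :
    P ∈ rowsF t r n ↔ ∀ i, P i ∈ wtS t n := by simp [rowsF]

lemma mem_sparseRows {t r n : ℕ} {P : Matrix (Fin r) (Fin n) (ZMod 2)} :
    P ∈ sparseRows t r n ↔ ∀ i, P i ∈ wtS t n := by
  unfold sparseRows
  rw [mem_filter]
  simp only [mem_univ, true_and, mem_wtS]

lemma card_rowsF (t r n : ℕ) : (rowsF t r n).card = (wtS t n).card ^ r := by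
  rw [rowsF, Fintype.card_piFinset]; simp

lemma card_sparseRows (t r n : ℕ) : (sparseRows t r n).card = (rowsF t r n).card := by
  apply Finset.card_nbij' (fun P i => P i) (fun P => Matrix.of P)
  · intro P hP; exact mem_rowsF.2 (mem_sparseRows.1 hP)
  · intro P hP; exact mem_sparseRows.2 (mem_rowsF.1 hP)
  · intro P _; rfl
  · intro P _; rfl

lemma sum_sparseRows (t r n : ℕ) (f : Matrix (Fin r) (Fin n) (ZMod 2) → ℝ) :
    ∑ P ∈ sparseRows t r n, f P = ∑ P ∈ rowsF t r n, f (Matrix.of P) := by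
  apply Finset.sum_nbij' (fun P i => P i) (fun P => Matrix.of P)
  · intro P hP; exact mem_rowsF.2 (mem_sparseRows.1 hP)
  · intro P hP; exact mem_sparseRows.2 (mem_rowsF.1 hP)
  · intro P _; rfl
  · intro P _; rfl
  · intro P _; rfl

lemma sum_rowsF_succ (t r n : ℕ) (f : (Fin (r+1) → Fin n → ZMod 2) → ℝ) :
    ∑ P ∈ rowsF t (r+1) n, f P =
      ∑ P ∈ rowsF t r n, ∑ p ∈ wtS t n, f (Fin.cons p P : Fin (r+1) → Fin n → ZMod 2) := by
  rw [← Finset.sum_product']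
  apply Finset.sum_nbij' (fun P => (Fin.tail P, P 0))
    (fun x => (Fin.cons x.2 x.1 : Fin (r+1) → Fin n → ZMod 2))
  · intro P hP
    rw [mem_rowsF] at hP
    rw [mem_product]
    exact ⟨mem_rowsF.2 fun i => hP i.succ, hP 0⟩
  · rintro ⟨P, p⟩ hP
    rw [mem_product] at hP
    rw [mem_rowsF]
    intro i
    refine Fin.cases ?_ (fun j => ?_) i
    · exact hP.2
    · exact mem_rowsF.1 hP.1 j
  · intro P _; exact Fin.cons_self_tail P
  · rintro ⟨P, p⟩ _; rfl
  · intro P _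
    exact congrArg f (Fin.cons_self_tail P).symm

/-- The normalised character sum. -/
def kap (t n : ℕ) (χ : Fin n → ZMod 2) : ℝ :=
  (1 / ((wtS t n).card : ℝ)) * ∑ p ∈ wtS t n, sg (p ⬝ᵥ χ)

lemma kap_abs_le (t n : ℕ) (χ) : |kap t n χ| ≤ 1 := by
  unfold kap
  rw [abs_mul, abs_of_nonneg (by positivity)]
  have : |∑ p ∈ wtS t n, sg (p ⬝ᵥ χ)| ≤ (wtS t n).card := by
    refine (Finset.abs_sum_le_sum_abs _ _).trans ?_
    simp [sg_abs]
  rw [one_div, inv_mul_eq_div]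
  exact div_le_one_of_le₀ this (by positivity)

/-- matrices with columns in the kernel -/
def kM (n g : ℕ) {r : ℕ} (P : Fin r → Fin n → ZMod 2) : Finset (Matrix (Fin n) (Fin g) (ZMod 2)) :=
  kerMats n g (Matrix.of P)

lemma mem_kM {n g r : ℕ} (P : Fin r → Fin n → ZMod 2) (G) :
    G ∈ kM n g P ↔ ∀ j, (fun i => G i j) ∈ kerF P := mem_kerMats (Matrix.of P) G

lemma card_kM {n g r : ℕ} (P : Fin r → Fin n → ZMod 2) :
    (kM n g P).card = (kerF P).card ^ g := card_kerMats (Matrix.of P)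

/-- density -/
def wK (n g : ℕ) {r : ℕ} (P : Fin r → Fin n → ZMod 2) (G : Matrix (Fin n) (Fin g) (ZMod 2)) : ℝ :=
  if G ∈ kM n g P then 1 / ((kM n g P).card : ℝ) else 0

lemma margMass_eq (n g t r : ℕ) (G) : margMass n g t r G =
    (1 / ((rowsF t r n).card : ℝ)) * ∑ P ∈ rowsF t r n, wK n g P G := by
  unfold margMass
  rw [sum_sparseRows, card_sparseRows]
  congr 1
  apply Finset.sum_congr rfl
  intro P _
  simp [kerMats, wK, kM]

lemma bad_avg (t n r : ℕ) (hS : (wtS t n).Nonempty) :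
    (1 / ((rowsF t r n).card : ℝ)) * ∑ P ∈ rowsF t r n,
      ((1 / ((wtS t n).card : ℝ)) ^ 2 * ∑ p ∈ wtS t n, ∑ q ∈ wtS t n,
        (if ∀ v ∈ kerF P, (p + q) ⬝ᵥ v = 0 then (1:ℝ) else 0)) ≤
    (1 / 2 ^ n) * ∑ χ, kap t n χ ^ 2 * (1 + kap t n χ) ^ r := by
  have hs : (0:ℝ) < ((wtS t n).card : ℝ) := by exact_mod_cast Finset.card_pos.2 hS
  have key : ∑ P ∈ rowsF t r n, ∑ p ∈ wtS t n, ∑ q ∈ wtS t n,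
        (if ∀ v ∈ kerF P, (p + q) ⬝ᵥ v = 0 then (1:ℝ) else 0) ≤
      ∑ P ∈ rowsF t r n, ∑ p ∈ wtS t n, ∑ q ∈ wtS t n, (1 / 2 ^ n) *
        ∑ χ : Fin n → ZMod 2, sg (p ⬝ᵥ χ) * sg (q ⬝ᵥ χ) * ∏ i, (1 + sg (P i ⬝ᵥ χ)) := by
    apply Finset.sum_le_sum; intro P _
    apply Finset.sum_le_sum; intro p _
    apply Finset.sum_le_sum; intro q _
    exact bad_le P p q
  have key2 : ∑ P ∈ rowsF t r n, ∑ p ∈ wtS t n, ∑ q ∈ wtS t n, (1 / 2 ^ n) *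
        ∑ χ : Fin n → ZMod 2, sg (p ⬝ᵥ χ) * sg (q ⬝ᵥ χ) * ∏ i, (1 + sg (P i ⬝ᵥ χ))
      = (1 / 2 ^ n) * ∑ χ : Fin n → ZMod 2, (∑ p ∈ wtS t n, sg (p ⬝ᵥ χ)) ^ 2 *
        (∑ p ∈ wtS t n, (1 + sg (p ⬝ᵥ χ))) ^ r := by
    simp_rw [← Finset.mul_sum]
    congr 1
    have e1 : ∀ χ : Fin n → ZMod 2, (∑ p ∈ wtS t n, (1 + sg (p ⬝ᵥ χ))) ^ r =
        ∑ P ∈ rowsF t r n, ∏ i, (1 + sg (P i ⬝ᵥ χ)) := by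
      intro χ
      rw [rowsF, Finset.sum_prod_piFinset (wtS t n) (fun (_ : Fin r) p => 1 + sg (p ⬝ᵥ χ))]
      simp
    have e2 : ∀ P : Fin r → Fin n → ZMod 2, ∑ p ∈ wtS t n, ∑ q ∈ wtS t n,
        ∑ χ : Fin n → ZMod 2, sg (p ⬝ᵥ χ) * sg (q ⬝ᵥ χ) * ∏ i, (1 + sg (P i ⬝ᵥ χ)) =
        ∑ χ : Fin n → ZMod 2, (∑ p ∈ wtS t n, sg (p ⬝ᵥ χ)) ^ 2 * ∏ i, (1 + sg (P i ⬝ᵥ χ)) := by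
      intro P
      rw [Finset.sum_congr rfl (fun p _ => Finset.sum_comm), Finset.sum_comm]
      apply Finset.sum_congr rfl
      intro χ _
      rw [sq, Finset.sum_mul_sum, Finset.sum_mul]
      apply Finset.sum_congr rfl
      intro p _
      rw [Finset.sum_mul]
    simp_rw [e2]
    rw [Finset.sum_comm]
    apply Finset.sum_congr rfl
    intro χ _
    rw [e1, Finset.mul_sum]
  have key3 : ∀ χ, kap t n χ ^ 2 * (1 + kap t n χ) ^ r = (1 / ((wtS t n).card : ℝ)) ^ 2 *
      (1 / ((wtS t n).card : ℝ) ^ r) * ((∑ p ∈ wtS t n, sg (p ⬝ᵥ χ)) ^ 2 *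
        (∑ p ∈ wtS t n, (1 + sg (p ⬝ᵥ χ))) ^ r) := by
    intro χ
    have : ∑ p ∈ wtS t n, (1 + sg (p ⬝ᵥ χ)) = (wtS t n).card * (1 + kap t n χ) := by
      rw [Finset.sum_add_distrib, kap]; simp; field_simp
    rw [this, kap, mul_pow, mul_pow]
    field_simp
  simp_rw [key3]
  rw [← Finset.mul_sum, ← Finset.mul_sum, card_rowsF, Nat.cast_pow]
  have := key.trans key2.le
  have hpos : (0:ℝ) ≤ (1 / ((wtS t n).card : ℝ)) ^ 2 * (1 / ((wtS t n).card : ℝ) ^ r) := by positivity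
  calc _ = ((1 / ((wtS t n).card : ℝ)) ^ 2 * (1 / ((wtS t n).card : ℝ) ^ r)) * ∑ P ∈ rowsF t r n, ∑ p ∈ wtS t n, ∑ q ∈ wtS t n,
        (if ∀ v ∈ kerF P, (p + q) ⬝ᵥ v = 0 then (1:ℝ) else 0) := by ring
    _ ≤ _ := mul_le_mul_of_nonneg_left this hpos
    _ = _ := by ring

set_option maxHeartbeats 2000000 in
/-- one step, fixed `P` -/
lemma step_P (t n g r : ℕ) (hS : (wtS t n).Nonempty) (P : Fin r → Fin n → ZMod 2) :
    (∑ G : Matrix (Fin n) (Fin g) (ZMod 2), |(1 / ((wtS t n).card : ℝ)) *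
      ∑ p ∈ wtS t n, wK n g (Fin.cons p P : Fin (r+1) → Fin n → ZMod 2) G - wK n g P G|) ^ 2 ≤
    2 ^ g * ((1 / ((wtS t n).card : ℝ)) ^ 2 * ∑ p ∈ wtS t n, ∑ q ∈ wtS t n,
        (if ∀ v ∈ kerF P, (p + q) ⬝ᵥ v = 0 then (1:ℝ) else 0)) := by
  have hs : (0:ℝ) < ((wtS t n).card : ℝ) := by exact_mod_cast Finset.card_pos.2 hS
  have h := step_gen (kM n g P) (fun p => kM n g (Fin.cons p P : Fin (r+1) → Fin n → ZMod 2))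
    (wtS t n) hS
    (by
      intro p _ G hG
      rw [mem_kM] at hG ⊢
      intro j
      exact ((mem_kerF_cons P p _).1 (hG j)).2)
    (by
      intro p _
      rw [card_kM]
      exact pow_pos (kerF_pos _) _)
  refine h.trans ?_
  have h1 : ∀ p q, ((kM n g P).card * (kM n g (Fin.cons p P : Fin (r+1) → Fin n → ZMod 2) ∩
      kM n g (Fin.cons q P : Fin (r+1) → Fin n → ZMod 2)).card : ℝ) /
      ((kM n g (Fin.cons p P : Fin (r+1) → Fin n → ZMod 2)).card *
        (kM n g (Fin.cons q P : Fin (r+1) → Fin n → ZMod 2)).card) ≤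
      1 + 2 ^ g * (if ∀ v ∈ kerF P, (p + q) ⬝ᵥ v = 0 then (1:ℝ) else 0) := by
    intro p q
    have e : kM n g (Fin.cons p P : Fin (r+1) → Fin n → ZMod 2) ∩
      kM n g (Fin.cons q P : Fin (r+1) → Fin n → ZMod 2) =
      kM n g (Fin.cons p (Fin.cons q P : Fin (r+1) → Fin n → ZMod 2) :
      Fin (r+2) → Fin n → ZMod 2) := by
      ext G
      rw [mem_inter, mem_kM, mem_kM, mem_kM, ← forall_and]
      apply forall_congr'
      intro j
      simp only [mem_kerF_cons]
      tauto
    have p1 : (0:ℝ) < (kerF (Fin.cons p P : Fin (r+1) → Fin n → ZMod 2)).card := by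
      exact_mod_cast kerF_pos _
    have p2 : (0:ℝ) < (kerF (Fin.cons q P : Fin (r+1) → Fin n → ZMod 2)).card := by
      exact_mod_cast kerF_pos _
    rw [e, card_kM, card_kM, card_kM, card_kM]
    push_cast
    rw [← mul_pow, ← mul_pow, div_le_iff₀ (by positivity)]
    split_ifs with hb
    · have := kerF_bad P p q
      have h4 : ((kerF P).card * (kerF (Fin.cons p (Fin.cons q P : Fin (r+1) → Fin n → ZMod 2) :
        Fin (r+2) → Fin n → ZMod 2)).card : ℝ)
        ≤ 2 * ((kerF (Fin.cons p P : Fin (r+1) → Fin n → ZMod 2)).card *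
        (kerF (Fin.cons q P : Fin (r+1) → Fin n → ZMod 2)).card) := by exact_mod_cast this
      have h5 := pow_le_pow_left₀ (by positivity) h4 g
      rw [mul_pow 2] at h5
      refine h5.trans ?_
      apply mul_le_mul_of_nonneg_right _ (by positivity)
      linarith
    · have := kerF_good P p q hb
      have h4 : ((kerF P).card * (kerF (Fin.cons p (Fin.cons q P : Fin (r+1) → Fin n → ZMod 2) :
        Fin (r+2) → Fin n → ZMod 2)).card : ℝ)
        = ((kerF (Fin.cons p P : Fin (r+1) → Fin n → ZMod 2)).card *
        (kerF (Fin.cons q P : Fin (r+1) → Fin n → ZMod 2)).card) := by exact_mod_cast this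
      rw [h4]; simp
  have h2 : ∑ p ∈ wtS t n, ∑ q ∈ wtS t n, ((kM n g P).card * (kM n g (Fin.cons p P : Fin (r+1) → Fin n → ZMod 2) ∩
      kM n g (Fin.cons q P : Fin (r+1) → Fin n → ZMod 2)).card : ℝ) /
      ((kM n g (Fin.cons p P : Fin (r+1) → Fin n → ZMod 2)).card *
        (kM n g (Fin.cons q P : Fin (r+1) → Fin n → ZMod 2)).card) ≤
      ∑ p ∈ wtS t n, ∑ q ∈ wtS t n,
      (1 + 2 ^ g * (if ∀ v ∈ kerF P, (p + q) ⬝ᵥ v = 0 then (1:ℝ) else 0)) :=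
    Finset.sum_le_sum fun p _ => Finset.sum_le_sum fun q _ => h1 p q
  have h3 := mul_le_mul_of_nonneg_left h2 (sq_nonneg (1 / ((wtS t n).card : ℝ)))
  simp_rw [Finset.sum_add_distrib, ← Finset.mul_sum] at h3
  simp only [sum_const, smul_eq_mul, nsmul_eq_mul, mul_one] at h3
  have h6 : (1 / ((wtS t n).card : ℝ)) ^ 2 * ((wtS t n).card * (wtS t n).card) = 1 := by field_simp
  rw [mul_add, h6] at h3
  linarith

lemma step_r (t n g r : ℕ) (hS : (wtS t n).Nonempty) :
    (∑ G : Matrix (Fin n) (Fin g) (ZMod 2), |margMass n g t (r+1) G - margMass n g t r G|) ^ 2 ≤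
    2 ^ g * ((1 / 2 ^ n) * ∑ χ, kap t n χ ^ 2 * (1 + kap t n χ) ^ r) := by
  have hs : (0:ℝ) < ((wtS t n).card : ℝ) := by exact_mod_cast Finset.card_pos.2 hS
  set D : (Fin r → Fin n → ZMod 2) → ℝ := fun P =>
    ∑ G : Matrix (Fin n) (Fin g) (ZMod 2), |(1 / ((wtS t n).card : ℝ)) *
      ∑ p ∈ wtS t n, wK n g (Fin.cons p P : Fin (r+1) → Fin n → ZMod 2) G - wK n g P G| with hD
  have hR : (0:ℝ) < ((rowsF t r n).card : ℝ) := by rw [card_rowsF]; push_cast; positivity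
  have h1 : ∑ G : Matrix (Fin n) (Fin g) (ZMod 2), |margMass n g t (r+1) G - margMass n g t r G| ≤
      (1 / ((rowsF t r n).card : ℝ)) * ∑ P ∈ rowsF t r n, D P := by
    simp only [hD]
    rw [Finset.sum_comm, Finset.mul_sum]
    apply Finset.sum_le_sum
    intro G _
    rw [margMass_eq, margMass_eq, sum_rowsF_succ]
    have : (1 / ((rowsF t (r+1) n).card : ℝ)) * ∑ P ∈ rowsF t r n, ∑ p ∈ wtS t n,
        wK n g (Fin.cons p P : Fin (r+1) → Fin n → ZMod 2) G -
        (1 / ((rowsF t r n).card : ℝ)) * ∑ P ∈ rowsF t r n, wK n g P G =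
        (1 / ((rowsF t r n).card : ℝ)) * ∑ P ∈ rowsF t r n, ((1 / ((wtS t n).card : ℝ)) *
      ∑ p ∈ wtS t n, wK n g (Fin.cons p P : Fin (r+1) → Fin n → ZMod 2) G - wK n g P G) := by
      rw [Finset.sum_sub_distrib, ← Finset.mul_sum, card_rowsF, card_rowsF]
      push_cast
      rw [pow_succ]
      field_simp
    rw [this, abs_mul, abs_of_pos (by positivity)]
    exact mul_le_mul_of_nonneg_left (Finset.abs_sum_le_sum_abs _ _) (by positivity)
  have h0 : 0 ≤ ∑ G : Matrix (Fin n) (Fin g) (ZMod 2), |margMass n g t (r+1) G - margMass n g t r G| :=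
    Finset.sum_nonneg fun _ _ => abs_nonneg _
  refine (pow_le_pow_left₀ h0 h1 2).trans ?_
  rw [mul_pow]
  have h2 := sq_sum_le_card_mul_sum_sq (s := rowsF t r n) (f := D)
  have h3 : ∑ P ∈ rowsF t r n, D P ^ 2 ≤ ∑ P ∈ rowsF t r n,
      2 ^ g * ((1 / ((wtS t n).card : ℝ)) ^ 2 * ∑ p ∈ wtS t n, ∑ q ∈ wtS t n,
        (if ∀ v ∈ kerF P, (p + q) ⬝ᵥ v = 0 then (1:ℝ) else 0)) :=
    Finset.sum_le_sum fun P _ => step_P t n g r hS P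
  rw [← Finset.mul_sum] at h3
  have h4 := mul_le_mul_of_nonneg_left (bad_avg t n r hS) (by positivity : (0:ℝ) ≤ 2 ^ g)
  refine le_trans ?_ h4
  calc _ ≤ (1 / ((rowsF t r n).card : ℝ)) ^ 2 * ((rowsF t r n).card * ∑ P ∈ rowsF t r n, D P ^ 2) :=
        mul_le_mul_of_nonneg_left h2 (by positivity)
    _ = (1 / ((rowsF t r n).card : ℝ)) * ∑ P ∈ rowsF t r n, D P ^ 2 := by field_simp
    _ ≤ (1 / ((rowsF t r n).card : ℝ)) * _ := mul_le_mul_of_nonneg_left h3 (by positivity)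
    _ = _ := by ring

/-- the analytic quantity -/
def Aq (t n r : ℕ) : ℝ := (1 / 2 ^ n) * ∑ χ : Fin n → ZMod 2, kap t n χ ^ 2 * (1 + |kap t n χ|) ^ r

lemma margMass_zero (t n g : ℕ) (G) : margMass n g t 0 G =
    1 / (Fintype.card (Matrix (Fin n) (Fin g) (ZMod 2)) : ℝ) := by
  have h : ∀ P : Fin 0 → Fin n → ZMod 2, kM n g P = univ := by
    intro P
    ext G
    rw [mem_kM]
    simp [mem_kerF]
  rw [margMass_eq]
  simp only [wK, h]
  simp [card_rowsF]

lemma SD_le (t n g r : ℕ) (hS : (wtS t n).Nonempty) :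
    ∑ G : Matrix (Fin n) (Fin g) (ZMod 2), |margMass n g t r G -
      1 / (Fintype.card (Matrix (Fin n) (Fin g) (ZMod 2)) : ℝ)| ≤ r * Real.sqrt (2 ^ g * Aq t n r) := by
  have h1 : ∀ i ≤ r, ∑ G : Matrix (Fin n) (Fin g) (ZMod 2), |margMass n g t i G -
      1 / (Fintype.card (Matrix (Fin n) (Fin g) (ZMod 2)) : ℝ)| ≤ i * Real.sqrt (2 ^ g * Aq t n r) := by
    intro i
    induction i with
    | zero => intro _; simp [margMass_zero]
    | succ i ih =>
      intro hi
      have h2 := step_r t n g i hS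
      have h3 : (1 / 2 ^ n) * ∑ χ, kap t n χ ^ 2 * (1 + kap t n χ) ^ i ≤ Aq t n r := by
        unfold Aq
        apply mul_le_mul_of_nonneg_left _ (by positivity)
        apply Finset.sum_le_sum
        intro χ _
        apply mul_le_mul_of_nonneg_left _ (sq_nonneg _)
        have := abs_le.1 (kap_abs_le t n χ)
        calc (1 + kap t n χ) ^ i ≤ (1 + |kap t n χ|) ^ i :=
              pow_le_pow_left₀ (by linarith) (by linarith [le_abs_self (kap t n χ)]) _
          _ ≤ _ := pow_le_pow_right₀ (by linarith [abs_nonneg (kap t n χ)]) (by omega)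
      have h4 := Real.le_sqrt_of_sq_le (h2.trans (mul_le_mul_of_nonneg_left h3 (by positivity)))
      have h5 := ih (by omega)
      push_cast
      have h6 : ∑ G : Matrix (Fin n) (Fin g) (ZMod 2), |margMass n g t (i+1) G -
          1 / (Fintype.card (Matrix (Fin n) (Fin g) (ZMod 2)) : ℝ)| ≤
          ∑ G : Matrix (Fin n) (Fin g) (ZMod 2), |margMass n g t (i+1) G - margMass n g t i G| +
          ∑ G : Matrix (Fin n) (Fin g) (ZMod 2), |margMass n g t i G -
          1 / (Fintype.card (Matrix (Fin n) (Fin g) (ZMod 2)) : ℝ)| := by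
        rw [← Finset.sum_add_distrib]
        exact Finset.sum_le_sum fun G _ => abs_sub_le _ _ _
      linarith
  exact h1 r le_rfl
lemma sg_sum {ι : Type*} (s : Finset ι) (f : ι → ZMod 2) : sg (∑ i ∈ s, f i) = ∏ i ∈ s, sg (f i) := by
  induction s using Finset.induction_on with
  | empty => simp [sg_zero]
  | insert a s ha ih => rw [Finset.sum_insert ha, Finset.prod_insert ha, sg_add, ih]

/-- generating polynomial -/
def Fp {n : ℕ} (χ : Fin n → ZMod 2) : Polynomial ℝ :=
  ∏ i, (1 + Polynomial.C (sg (χ i)) * Polynomial.X)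

lemma sum_zmod2 {M : Type*} [AddCommMonoid M] (f : ZMod 2 → M) : ∑ b : ZMod 2, f b = f 0 + f 1 :=
  Fin.sum_univ_two f

lemma hamming_sum {n : ℕ} (p : Fin n → ZMod 2) : hammingNorm p = ∑ i, (if p i = 0 then 0 else 1) := by
  unfold hammingNorm
  rw [Finset.card_filter]
  apply Finset.sum_congr rfl
  intro i _
  by_cases h : p i = 0 <;> simp [h]

lemma Fp_eq {n : ℕ} (χ : Fin n → ZMod 2) : Fp χ =
    ∑ p : Fin n → ZMod 2, Polynomial.C (sg (p ⬝ᵥ χ)) * Polynomial.X ^ (hammingNorm p) := by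
  have h1 : ∀ i, (1 + Polynomial.C (sg (χ i)) * Polynomial.X : Polynomial ℝ) =
      ∑ b : ZMod 2, Polynomial.C (sg (b * χ i)) * Polynomial.X ^ (if b = 0 then 0 else 1) := by
    intro i
    rw [sum_zmod2]
    simp [sg_zero]
  unfold Fp
  simp_rw [h1]
  rw [Finset.prod_univ_sum]
  simp only [Fintype.piFinset_univ]
  apply Finset.sum_congr rfl
  intro p _
  rw [Finset.prod_mul_distrib, Finset.prod_pow_eq_pow_sum, hamming_sum, dotProduct, sg_sum, map_prod]

lemma Fp_coeff {n : ℕ} (χ : Fin n → ZMod 2) (t : ℕ) :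
    (Fp χ).coeff t = ∑ p ∈ wtS t n, sg (p ⬝ᵥ χ) := by
  rw [Fp_eq, Polynomial.finsetSum_coeff, wtS, Finset.sum_filter]
  apply Finset.sum_congr rfl
  intro p _
  rw [Polynomial.coeff_C_mul_X_pow]
  by_cases h : hammingNorm p = t
  · simp [h]
  · simp [h, Ne.symm h]

lemma card_wtS (t n : ℕ) : (wtS t n).card = n.choose t := by
  have h := Fp_coeff (0 : Fin n → ZMod 2) t
  have h2 : Fp (0 : Fin n → ZMod 2) = (1 + Polynomial.X) ^ n := by
    simp [Fp, sg_zero]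
  rw [h2, Polynomial.coeff_one_add_X_pow] at h
  simp [sg_zero] at h
  exact_mod_cast h.symm

/-- signed sum -/
def mm {n : ℕ} (χ : Fin n → ZMod 2) : ℝ := ∑ i, sg (χ i)

lemma mm_eq {n : ℕ} (χ : Fin n → ZMod 2) : mm χ = n - 2 * hammingNorm χ := by
  rw [hamming_sum, mm]
  push_cast
  rw [Finset.mul_sum]
  have : (n:ℝ) = ∑ i : Fin n, (1:ℝ) := by simp
  rw [this, ← Finset.sum_sub_distrib]
  apply Finset.sum_congr rfl
  intro i _
  by_cases h : χ i = 0 <;> simp [h, sg]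
  norm_num

open Polynomial in
lemma Fp_ode {ι : Type*} (s : Finset ι) (c : ι → ℝ) (hc : ∀ i, c i * c i = 1) :
    (1 - X ^ 2) * derivative (∏ i ∈ s, (1 + C (c i) * X)) =
      (∏ i ∈ s, (1 + C (c i) * X)) * (C (∑ i ∈ s, c i) - C (s.card : ℝ) * X) := by
  induction s using Finset.induction_on with
  | empty => simp
  | insert a s ha ih =>
    rw [Finset.prod_insert ha, Finset.sum_insert ha, Finset.card_insert_of_notMem ha, derivative_mul,
      mul_add]
    have h1 : derivative (1 + C (c a) * X : ℝ[X]) = C (c a) := by simp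
    rw [h1]
    have h2 : (1 - X ^ 2) * ((1 + C (c a) * X) * derivative (∏ i ∈ s, (1 + C (c i) * X))) =
      (1 + C (c a) * X) * ((∏ i ∈ s, (1 + C (c i) * X)) * (C (∑ i ∈ s, c i) - C (s.card : ℝ) * X)) := by
      rw [← ih]; ring
    rw [h2]
    have h3 : (C (c a) * C (c a) : ℝ[X]) = 1 := by rw [← C_mul, hc, C_1]
    push_cast
    simp only [C_add, C_1]
    linear_combination (-(∏ i ∈ s, (1 + C (c i) * X)) * X) * h3

open Polynomial in
lemma Fp_rec {n : ℕ} (χ : Fin n → ZMod 2) (j : ℕ) :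
    (j + 2 : ℝ) * (Fp χ).coeff (j + 2) - j * (Fp χ).coeff j =
      mm χ * (Fp χ).coeff (j + 1) - n * (Fp χ).coeff j := by
  have h := Fp_ode (univ : Finset (Fin n)) (fun i => sg (χ i)) (fun i => sg_sq _)
  have h' : (1 - X ^ 2) * derivative (Fp χ) = Fp χ * (C (mm χ) - C (n : ℝ) * X) := by
    simpa [Fp, mm] using h
  have h1 : derivative (Fp χ) - X * (X * derivative (Fp χ)) = C (mm χ) * Fp χ - C (n:ℝ) * (X * Fp χ) := by
    linear_combination h'
  have h2 := congrArg (fun q => q.coeff (j + 1)) h1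
  simp only [coeff_sub, coeff_C_mul, coeff_X_mul, coeff_derivative] at h2
  have h3 : (X * derivative (Fp χ)).coeff j = j * (Fp χ).coeff j := by
    cases j with
    | zero => simp
    | succ k => rw [coeff_X_mul, coeff_derivative]; push_cast; ring
  rw [h3] at h2
  push_cast at h2
  linear_combination h2

open Polynomial in
lemma Fp_zero {n : ℕ} (χ : Fin n → ZMod 2) : (Fp χ).coeff 0 = 1 := by
  rw [coeff_zero_eq_eval_zero, Fp, eval_prod]; simp

open Polynomial in
lemma Fp_one {n : ℕ} (χ : Fin n → ZMod 2) : (Fp χ).coeff 1 = mm χ := by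
  have h := Fp_ode (univ : Finset (Fin n)) (fun i => sg (χ i)) (fun i => sg_sq _)
  have h' : (1 - X ^ 2) * derivative (Fp χ) = Fp χ * (C (mm χ) - C (n : ℝ) * X) := by
    simpa [Fp, mm] using h
  have h1 : derivative (Fp χ) - X * (X * derivative (Fp χ)) = C (mm χ) * Fp χ - C (n:ℝ) * (X * Fp χ) := by
    linear_combination h'
  have h2 := congrArg (fun q => q.coeff 0) h1
  simp only [coeff_sub, coeff_C_mul, coeff_X_mul_zero, coeff_derivative, Fp_zero] at h2
  simpa using h2

lemma Fp_bound {n : ℕ} (χ : Fin n → ZMod 2) (T : ℕ) (hT : T ≤ n) (y : ℝ) (hy : 0 < y)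
    (h : |mm χ| * y + T ≤ (n - T) * y ^ 2) :
    ∀ j ≤ T, |(Fp χ).coeff j| ≤ n.choose j * y ^ j := by
  have hTn : (T:ℝ) ≤ n := by exact_mod_cast hT
  have hm : |mm χ| ≤ n * y := by
    have : |mm χ| * y ≤ (n * y) * y := by nlinarith [sq_nonneg y, (Nat.cast_nonneg T : (0:ℝ) ≤ T)]
    exact le_of_mul_le_mul_right this hy
  intro j
  induction j using Nat.strong_induction_on with
  | _ j ih =>
    match j, ih with
    | 0, _ => intro _; simp [Fp_zero]
    | 1, _ => intro _; simpa [Fp_one] using hm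
    | j + 2, ih =>
      intro hj
      have i1 := ih (j + 1) (by omega) (by omega)
      have i0 := ih j (by omega) (by omega)
      have hrec := Fp_rec χ j
      have hjT : (j:ℝ) + 2 ≤ T := by exact_mod_cast hj
      have c1 : ((j:ℝ) + 2) * n.choose (j + 2) = (n - (j + 1)) * n.choose (j + 1) := by
        have := Nat.choose_succ_right_eq n (j + 1)
        have h2 : ((n.choose (j + 1 + 1) * (j + 1 + 1) : ℕ) : ℝ) = (n.choose (j+1) * (n - (j+1)) : ℕ) := by
          rw [this]
        rw [Nat.cast_mul, Nat.cast_mul, Nat.cast_sub (by omega)] at h2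
        push_cast at h2
        linear_combination h2
      have c0 : ((j:ℝ) + 1) * n.choose (j + 1) = (n - j) * n.choose j := by
        have := Nat.choose_succ_right_eq n j
        have h2 : ((n.choose (j + 1) * (j + 1) : ℕ) : ℝ) = (n.choose j * (n - j) : ℕ) := by
          rw [this]
        rw [Nat.cast_mul, Nat.cast_mul, Nat.cast_sub (by omega)] at h2
        push_cast at h2
        linear_combination h2
      have e : ((j:ℝ) + 2) * (Fp χ).coeff (j + 2) = mm χ * (Fp χ).coeff (j + 1) - (n - j) * (Fp χ).coeff j := by
        linear_combination hrec
      have hb : ((j:ℝ) + 2) * |(Fp χ).coeff (j + 2)| ≤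
          |mm χ| * |(Fp χ).coeff (j + 1)| + (n - j) * |(Fp χ).coeff j| := by
        have h5 : ((j:ℝ) + 2) * |(Fp χ).coeff (j + 2)| = |((j:ℝ) + 2) * (Fp χ).coeff (j + 2)| := by
          rw [abs_mul, abs_of_nonneg (by positivity : (0:ℝ) ≤ (j:ℝ) + 2)]
        rw [h5, e]
        refine (abs_sub _ _).trans ?_
        rw [abs_mul, abs_mul, abs_of_nonneg (by linarith : (0:ℝ) ≤ (n:ℝ) - j)]
      have hC1 : (0:ℝ) ≤ n.choose (j + 1) := by positivity
      have hyj : 0 < y ^ j := by positivity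
      have s1 : |mm χ| * |(Fp χ).coeff (j + 1)| ≤ |mm χ| * (n.choose (j+1) * y ^ (j + 1)) :=
        mul_le_mul_of_nonneg_left i1 (abs_nonneg _)
      have s0 : ((n:ℝ) - j) * |(Fp χ).coeff j| ≤ (n - j) * (n.choose j * y ^ j) :=
        mul_le_mul_of_nonneg_left i0 (by linarith)
      have s2 : |mm χ| * y + (j + 1) ≤ (n - (j + 1)) * y ^ 2 := by
        nlinarith [sq_nonneg y]
      have s3 := mul_le_mul_of_nonneg_left s2 (mul_nonneg hC1 hyj.le)
      have : ((j:ℝ) + 2) * |(Fp χ).coeff (j + 2)| ≤ ((j:ℝ) + 2) * (n.choose (j + 2) * y ^ (j + 2)) := by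
        calc _ ≤ |mm χ| * (n.choose (j+1) * y ^ (j + 1)) + (n - j) * (n.choose j * y ^ j) := by linarith
          _ = n.choose (j+1) * y ^ j * (|mm χ| * y + (j + 1)) := by
            rw [pow_succ]; linear_combination (-y ^ j) * c0
          _ ≤ _ := s3
          _ = _ := by rw [pow_add]; linear_combination (-(y ^ j * y ^ 2)) * c1
      exact le_of_mul_le_mul_left this (by positivity)

lemma kap_bound {n : ℕ} (χ : Fin n → ZMod 2) (t : ℕ) (hT : t ≤ n) (y : ℝ) (hy : 0 < y)
    (h : |mm χ| * y + t ≤ (n - t) * y ^ 2) : |kap t n χ| ≤ y ^ t := by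
  have := Fp_bound χ t hT y hy h t le_rfl
  rw [Fp_coeff] at this
  unfold kap
  have hc : (0:ℝ) < n.choose t := by exact_mod_cast Nat.choose_pos hT
  rw [card_wtS, abs_mul, abs_of_pos (by positivity), one_div, inv_mul_le_iff₀ hc]
  exact this

lemma kap_sq_sum (t n : ℕ) (hT : t ≤ n) : (1 / 2 ^ n) * ∑ χ, kap t n χ ^ 2 = 1 / (n.choose t : ℝ) := by
  have hc : (0:ℝ) < n.choose t := by exact_mod_cast Nat.choose_pos hT
  have h0 : kerF (Fin.elim0 : Fin 0 → Fin n → ZMod 2) = univ := by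
    ext v; simp [mem_kerF]
  have horth : ∀ p q : Fin n → ZMod 2, ∑ χ, sg (p ⬝ᵥ χ) * sg (q ⬝ᵥ χ) = if p = q then 2 ^ n else 0 := by
    intro p q
    split_ifs with h
    · subst h
      simp [sg_sq, ZMod.card]
    · have := charsum_zero (Fin.elim0 : Fin 0 → Fin n → ZMod 2) (p + q) (by
        intro hh
        apply h
        ext i
        have h1 := hh (Pi.single i 1) (by simp [h0])
        rw [dotProduct_single] at h1
        have h3 : ∀ a b : ZMod 2, (a + b) * 1 = 0 → a = b := by decide
        exact h3 _ _ h1)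
      rw [h0] at this
      rw [← this]
      apply Finset.sum_congr rfl
      intro χ _
      rw [add_dotProduct, sg_add]
  have : ∑ χ : Fin n → ZMod 2, (∑ p ∈ wtS t n, sg (p ⬝ᵥ χ)) ^ 2 = n.choose t * 2 ^ n := by
    simp_rw [sq, Finset.sum_mul_sum]
    rw [Finset.sum_comm, ← card_wtS]
    rw [Finset.sum_congr rfl (g := fun _ => (2:ℝ) ^ n)]
    · simp
    · intro p hp
      rw [Finset.sum_comm]
      simp_rw [horth]
      rw [Finset.sum_ite_eq, if_pos hp]
  simp_rw [kap, mul_pow]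
  rw [← Finset.mul_sum, this, card_wtS]
  field_simp

lemma chernoff (n w : ℕ) (l : ℝ) :
    ((wtS w n).card : ℝ) * Real.exp (l * (n - 2 * w)) ≤ 2 ^ n * Real.cosh l ^ n := by
  have h1 : ∑ χ : Fin n → ZMod 2, Real.exp (l * mm χ) = 2 ^ n * Real.cosh l ^ n := by
    have : ∀ χ : Fin n → ZMod 2, Real.exp (l * mm χ) = ∏ i, Real.exp (l * sg (χ i)) := by
      intro χ
      rw [← Real.exp_sum, mm, Finset.mul_sum]
    simp_rw [this]
    have h2 := Finset.prod_univ_sum (fun _ : Fin n => (univ : Finset (ZMod 2))) (fun _ b => Real.exp (l * sg b))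
    simp only [Fintype.piFinset_univ] at h2
    rw [← h2, sum_zmod2, Finset.prod_const, ← mul_pow, Real.cosh_eq]
    simp [sg]
    ring
  rw [← h1]
  calc _ = ∑ χ ∈ wtS w n, Real.exp (l * mm χ) := by
        rw [Finset.sum_congr rfl (g := fun _ => Real.exp (l * (n - 2 * w)))]
        · simp
        · intro χ hχ
          rw [mm_eq, mem_wtS.1 hχ]
    _ ≤ _ := Finset.sum_le_univ_sum_of_nonneg fun _ => (Real.exp_pos _).le
lemma exp_neg8 : Real.exp (-8) ≤ 0.0004 := by
  have h1 := Real.exp_one_gt_d9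
  have h2 : Real.exp 8 = Real.exp 1 ^ 8 := by rw [← Real.exp_nat_mul]; norm_num
  have h3 : (2.7:ℝ) ^ 8 ≤ Real.exp 1 ^ 8 := pow_le_pow_left₀ (by norm_num) (by linarith) 8
  rw [Real.exp_neg, h2]
  have h4 : (2500:ℝ) ≤ Real.exp 1 ^ 8 := le_trans (by norm_num) h3
  calc (Real.exp 1 ^ 8)⁻¹ ≤ (2500:ℝ)⁻¹ := inv_anti₀ (by norm_num) h4
    _ = _ := by norm_num

lemma cosh4 : Real.cosh 4 ≤ Real.exp (3.994 - 0.99 * Real.log 2) := by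
  have h1 : Real.exp (-4) = Real.exp 4 * Real.exp (-8) := by rw [← Real.exp_add]; norm_num
  have h2 : 1 + Real.exp (-8) ≤ Real.exp 0.0004 := by
    have := Real.add_one_le_exp (0.0004:ℝ)
    linarith [exp_neg8]
  have h3 : Real.exp (3.994 - 0.99 * Real.log 2) = Real.exp (3.994 + 0.01 * Real.log 2) / 2 := by
    rw [eq_div_iff (by norm_num)]
    nth_rewrite 2 [← Real.exp_log (show (0:ℝ) < 2 by norm_num)]
    rw [← Real.exp_add]; congr 1; ring
  rw [Real.cosh_eq, h3, h1]
  have h4 : Real.exp 4 * Real.exp 0.0004 ≤ Real.exp (3.994 + 0.01 * Real.log 2) := by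
    rw [← Real.exp_add]
    apply Real.exp_le_exp.2
    linarith [Real.log_two_gt_d9]
  have h5 := mul_le_mul_of_nonneg_left h2 (Real.exp_pos 4).le
  linarith

/-- small-bias regime -/
lemma kap_small {n t : ℕ} (ht8 : 8 ≤ t) (u : ℝ) (hu : 0 < u) (hn : (n:ℝ) = u ^ 4)
    (hts : 10000 * (t:ℝ) ≤ u ^ 2) (χ : Fin n → ZMod 2) (hm : |mm χ| ≤ u ^ 3) :
    |kap t n χ| ≤ 1 / n := by
  have ht8' : (8:ℝ) ≤ t := by exact_mod_cast ht8
  have hu2 : 80000 ≤ u ^ 2 := by linarith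
  have hu4 : 80000 * u ^ 2 ≤ u ^ 4 := by nlinarith
  have htn : t ≤ n := by
    have : (t:ℝ) ≤ n := by rw [hn]; nlinarith
    exact_mod_cast this
  have hu200 : 200 ≤ u := by nlinarith
  have hy1 : 2 / u ≤ 1 := by rw [div_le_one hu]; linarith
  have h := kap_bound χ t htn (2 / u) (by positivity) (by
    have e1 : |mm χ| * (2 / u) ≤ 2 * u ^ 2 := by
      calc |mm χ| * (2 / u) ≤ u ^ 3 * (2 / u) := mul_le_mul_of_nonneg_right hm (by positivity)
        _ = _ := by field_simp
    have e2 : ((n:ℝ) - t) * (2 / u) ^ 2 = 4 * u ^ 2 - t * (4 / u ^ 2) := by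
      rw [hn]; field_simp; ring
    have e3 : (4 / u ^ 2) ≤ 1 := by rw [div_le_one (by positivity)]; linarith
    rw [e2]
    nlinarith)
  refine h.trans ?_
  calc (2 / u) ^ t ≤ (2 / u) ^ 8 := pow_le_pow_of_le_one (by positivity) hy1 ht8
    _ = 256 / (u ^ 4 * u ^ 4) := by rw [div_pow]; ring_nf
    _ ≤ 1 / n := by
      rw [hn, div_le_div_iff₀ (by positivity) (by positivity)]
      have : 256 ≤ u ^ 4 := by nlinarith
      nlinarith [pow_pos hu 4]

/-- middle regime -/
lemma kap_mid {n t : ℕ} (ht8 : 8 ≤ t) (u : ℝ) (hu : 0 < u) (hn : (n:ℝ) = u ^ 4)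
    (hts : 10000 * (t:ℝ) ≤ u ^ 2) (ht : (0.9995:ℝ) ^ (t - 2) ≤ 1 / 5) (χ : Fin n → ZMod 2)
    (hm : u ^ 3 < |mm χ|) (hm2 : |mm χ| ≤ 0.999 * n) :
    |kap t n χ| ≤ (|mm χ| / n) ^ 2 / 4 := by
  have ht8' : (8:ℝ) ≤ t := by exact_mod_cast ht8
  have hu2 : 80000 ≤ u ^ 2 := by linarith
  have hu4 : 80000 * u ^ 2 ≤ u ^ 4 := by nlinarith
  have htn : t ≤ n := by
    have : (t:ℝ) ≤ n := by rw [hn]; nlinarith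
    exact_mod_cast this
  have hnpos : (0:ℝ) < n := by rw [hn]; positivity
  set x := |mm χ| / n with hx
  have hmx : |mm χ| = n * x := by rw [hx]; field_simp
  have hx0 : 0 < x := by
    rw [hx]; apply div_pos _ hnpos
    exact lt_trans (by positivity) hm
  have hx1 : x ≤ 0.999 := by rw [hx, div_le_iff₀ hnpos]; exact hm2
  have hz : u ^ 2 ≤ n * x ^ 2 := by
    have h1 : u ^ 3 ≤ u ^ 4 * x := by rw [← hn, ← hmx]; exact hm.le
    have h2 : 1 ≤ u * x := by
      have : u ^ 3 * 1 ≤ u ^ 3 * (u * x) := by linarith [h1, (by ring : u ^ 3 * (u * x) = u ^ 4 * x)]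
      exact le_of_mul_le_mul_left this (by positivity)
    rw [hn]
    have h3 : 1 ≤ (u * x) ^ 2 := one_le_pow₀ h2
    nlinarith [sq_nonneg u]
  have h := kap_bound χ t htn (1.0005 * x) (by positivity) (by
    rw [hmx]
    have hx2 : x ^ 2 ≤ 1 := by nlinarith
    have : (t:ℝ) * x ^ 2 ≤ t := by nlinarith
    nlinarith)
  refine h.trans ?_
  have e : t = 2 + (t - 2) := by omega
  rw [e, pow_add]
  have e1 : (1.0005 * x) ^ (t - 2) ≤ 1 / 5 :=
    (pow_le_pow_left₀ (by positivity) (by linarith) _).trans ht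
  calc (1.0005 * x) ^ 2 * (1.0005 * x) ^ (t - 2) ≤ (1.0005 * x) ^ 2 * (1 / 5) :=
        mul_le_mul_of_nonneg_left e1 (by positivity)
    _ ≤ _ := by nlinarith [sq_nonneg x]

lemma mid_term {n t r : ℕ} (hr : (r:ℝ) ≤ 0.99 * n) (ht8 : 8 ≤ t) (u : ℝ) (hu : 0 < u)
    (hn : (n:ℝ) = u ^ 4)
    (hts : 10000 * (t:ℝ) ≤ u ^ 2) (ht : (0.9995:ℝ) ^ (t - 2) ≤ 1 / 5) (χ : Fin n → ZMod 2)
    (hm : u ^ 3 < |mm χ|) :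
    (1 + |kap t n χ|) ^ r * (wtS (hammingNorm χ) n).card ≤ 2 ^ n * Real.exp (- u ^ 2 / 4) := by
  have ht8' : (8:ℝ) ≤ t := by exact_mod_cast ht8
  have hu2 : 80000 ≤ u ^ 2 := by linarith
  have hu4 : 80000 * u ^ 2 ≤ u ^ 4 := by nlinarith
  have hnpos : (0:ℝ) < n := by rw [hn]; positivity
  have hch : ∀ l : ℝ, ((wtS (hammingNorm χ) n).card : ℝ) ≤ 2 ^ n * Real.cosh l ^ n * Real.exp (- (l * mm χ)) := by
    intro l
    have := chernoff n (hammingNorm χ) l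
    rw [← mm_eq] at this
    rw [Real.exp_neg, ← div_eq_mul_inv, le_div_iff₀ (Real.exp_pos _)]
    exact this
  have hch' : ∀ l : ℝ, ((wtS (hammingNorm χ) n).card : ℝ) ≤ 2 ^ n * Real.cosh l ^ n * Real.exp (- (l * |mm χ|)) := by
    intro l
    rcases abs_choice (mm χ) with h | h
    · rw [h]; exact hch l
    · have := hch (-l)
      rw [Real.cosh_neg] at this
      rw [h]
      convert this using 3
      ring
  by_cases hm2 : |mm χ| ≤ 0.999 * n
  · have hk := kap_mid ht8 u hu hn hts ht χ hm hm2
    set x := |mm χ| / n with hx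
    have hmx : |mm χ| = n * x := by rw [hx]; field_simp
    have hz : u ^ 2 ≤ n * x ^ 2 := by
      have h1 : u ^ 3 ≤ u ^ 4 * x := by rw [← hn, ← hmx]; exact hm.le
      have h2 : 1 ≤ u * x := by
        have : u ^ 3 * 1 ≤ u ^ 3 * (u * x) := by linarith [h1, (by ring : u ^ 3 * (u * x) = u ^ 4 * x)]
        exact le_of_mul_le_mul_left this (by positivity)
      rw [hn]
      have h3 : 1 ≤ (u * x) ^ 2 := one_le_pow₀ h2
      nlinarith [sq_nonneg u]
    have a1 : (1 + |kap t n χ|) ^ r ≤ Real.exp (n * x ^ 2 / 4) := by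
      calc (1 + |kap t n χ|) ^ r ≤ Real.exp (x ^ 2 / 4) ^ r := by
            apply pow_le_pow_left₀ (by positivity)
            have := Real.add_one_le_exp (x ^ 2 / 4)
            linarith
        _ = Real.exp (r * (x ^ 2 / 4)) := by rw [← Real.exp_nat_mul]
        _ ≤ _ := by
          apply Real.exp_le_exp.2
          have : (r:ℝ) ≤ n := by linarith
          nlinarith [sq_nonneg x]
    have a2 : ((wtS (hammingNorm χ) n).card : ℝ) ≤ 2 ^ n * Real.exp (- (n * x ^ 2 / 2)) := by
      refine (hch' x).trans ?_
      rw [mul_assoc]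
      apply mul_le_mul_of_nonneg_left _ (by positivity)
      calc Real.cosh x ^ n * Real.exp (-(x * |mm χ|)) ≤ Real.exp (x ^ 2 / 2) ^ n * Real.exp (-(x * |mm χ|)) := by
            apply mul_le_mul_of_nonneg_right _ (Real.exp_pos _).le
            exact pow_le_pow_left₀ (Real.cosh_pos x).le (Real.cosh_le_exp_half_sq x) n
        _ = _ := by
          rw [← Real.exp_nat_mul, ← Real.exp_add, hmx]; congr 1; ring
    calc _ ≤ Real.exp (n * x ^ 2 / 4) * (2 ^ n * Real.exp (- (n * x ^ 2 / 2))) :=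
          mul_le_mul a1 a2 (Nat.cast_nonneg _) (Real.exp_pos _).le
      _ = 2 ^ n * Real.exp (- (n * x ^ 2 / 4)) := by
          rw [mul_left_comm, ← Real.exp_add]; congr 2; ring
      _ ≤ _ := by
        apply mul_le_mul_of_nonneg_left _ (by positivity)
        apply Real.exp_le_exp.2
        linarith
  · push Not at hm2
    have a1 : (1 + |kap t n χ|) ^ r ≤ Real.exp (0.99 * n * Real.log 2) := by
      calc (1 + |kap t n χ|) ^ r ≤ 2 ^ r := by
            apply pow_le_pow_left₀ (by positivity)
            linarith [kap_abs_le t n χ]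
        _ = Real.exp (r * Real.log 2) := by
          rw [Real.exp_nat_mul, Real.exp_log (by norm_num)]
        _ ≤ _ := by
          apply Real.exp_le_exp.2
          exact mul_le_mul_of_nonneg_right hr (Real.log_nonneg (by norm_num))
    have a2 : ((wtS (hammingNorm χ) n).card : ℝ) ≤ 2 ^ n * Real.exp (n * (3.994 - 0.99 * Real.log 2) - 3.996 * n) := by
      refine (hch' 4).trans ?_
      rw [mul_assoc]
      apply mul_le_mul_of_nonneg_left _ (by positivity)
      calc Real.cosh 4 ^ n * Real.exp (-(4 * |mm χ|)) ≤
          Real.exp (3.994 - 0.99 * Real.log 2) ^ n * Real.exp (-(4 * |mm χ|)) := by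
            apply mul_le_mul_of_nonneg_right _ (Real.exp_pos _).le
            exact pow_le_pow_left₀ (Real.cosh_pos _).le cosh4 n
        _ ≤ _ := by
          rw [← Real.exp_nat_mul, ← Real.exp_add]
          apply Real.exp_le_exp.2
          linarith
    calc _ ≤ Real.exp (0.99 * n * Real.log 2) * (2 ^ n * Real.exp (n * (3.994 - 0.99 * Real.log 2) - 3.996 * n)) :=
          mul_le_mul a1 a2 (Nat.cast_nonneg _) (Real.exp_pos _).le
      _ = 2 ^ n * Real.exp (- (0.002 * n)) := by
          rw [mul_left_comm, ← Real.exp_add]; congr 2; ring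
      _ ≤ _ := by
        apply mul_le_mul_of_nonneg_left _ (by positivity)
        apply Real.exp_le_exp.2
        rw [hn]
        linarith

lemma Aq_bound {n t r : ℕ} (hr : (r:ℝ) ≤ 0.99 * n) (ht8 : 8 ≤ t)
    (hts : 10000 * (t:ℝ) ≤ Real.sqrt n) (ht : (0.9995:ℝ) ^ (t - 2) ≤ 1 / 5) :
    Aq t n r ≤ 3 / (n.choose t : ℝ) + (n + 1) * Real.exp (- Real.sqrt n / 4) := by
  have ht8' : (8:ℝ) ≤ t := by exact_mod_cast ht8
  set u := Real.sqrt (Real.sqrt n) with hudef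
  have hu2 : u ^ 2 = Real.sqrt n := Real.sq_sqrt (Real.sqrt_nonneg _)
  have hn : (n:ℝ) = u ^ 4 := by
    have : u ^ 4 = (u ^ 2) ^ 2 := by ring
    rw [this, hu2, Real.sq_sqrt (Nat.cast_nonneg n)]
  have hu : 0 < u := by
    apply Real.sqrt_pos.2
    linarith
  rw [← hu2] at hts ⊢
  have hnpos : (0:ℝ) < n := by rw [hn]; positivity
  have htn : t ≤ n := by
    have : (t:ℝ) ≤ n := by rw [hn]; nlinarith
    exact_mod_cast this
  set E := Real.exp (- u ^ 2 / 4) with hE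
  have hEpos : 0 < E := Real.exp_pos _
  have hcard : ∀ χ : Fin n → ZMod 2, (0:ℝ) < (wtS (hammingNorm χ) n).card := by
    intro χ
    exact_mod_cast Finset.card_pos.2 ⟨χ, mem_wtS.2 rfl⟩
  have hpt : ∀ χ : Fin n → ZMod 2, kap t n χ ^ 2 * (1 + |kap t n χ|) ^ r ≤
      3 * kap t n χ ^ 2 + 2 ^ n * E / (wtS (hammingNorm χ) n).card := by
    intro χ
    have hc := hcard χ
    by_cases hm : |mm χ| ≤ u ^ 3
    · have hk := kap_small ht8 u hu hn hts χ hm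
      have : (1 + |kap t n χ|) ^ r ≤ 3 := by
        calc (1 + |kap t n χ|) ^ r ≤ Real.exp (1 / n) ^ r := by
              apply pow_le_pow_left₀ (by positivity)
              have := Real.add_one_le_exp (1 / n : ℝ)
              linarith
          _ = Real.exp (r * (1 / n)) := by rw [← Real.exp_nat_mul]
          _ ≤ Real.exp 1 := by
            apply Real.exp_le_exp.2
            rw [mul_one_div, div_le_one hnpos]; linarith
          _ ≤ 3 := by linarith [Real.exp_one_lt_d9]
      have h1 := mul_le_mul_of_nonneg_left this (sq_nonneg (kap t n χ))
      have h2 : 0 ≤ 2 ^ n * E / (wtS (hammingNorm χ) n).card :=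
        div_nonneg (by positivity) hc.le
      linarith
    · push Not at hm
      have h1 := mid_term hr ht8 u hu hn hts ht χ hm
      rw [← le_div_iff₀ hc] at h1
      have hk2 : kap t n χ ^ 2 ≤ 1 := by
        have := kap_abs_le t n χ
        rw [← sq_abs]
        exact pow_le_one₀ (abs_nonneg _) this
      have h3 : kap t n χ ^ 2 * (1 + |kap t n χ|) ^ r ≤ 1 * (1 + |kap t n χ|) ^ r :=
        mul_le_mul_of_nonneg_right hk2 (by positivity)
      nlinarith [sq_nonneg (kap t n χ)]
  have hfib : ∑ χ : Fin n → ZMod 2, 2 ^ n * E / (wtS (hammingNorm χ) n).card ≤ (n + 1) * (2 ^ n * E) := by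
    rw [← Finset.sum_fiberwise_of_maps_to (s := univ) (t := range (n + 1)) (g := fun χ : Fin n → ZMod 2 => hammingNorm χ)
      (by
        intro χ _
        rw [mem_range]
        have := hammingNorm_le_card_fintype (x := χ)
        simp at this
        omega)]
    calc _ ≤ ∑ w ∈ range (n + 1), 2 ^ n * E := by
          apply Finset.sum_le_sum
          intro w _
          have : (univ.filter fun χ : Fin n → ZMod 2 => hammingNorm χ = w) = wtS w n := rfl
          rw [this, Finset.sum_congr rfl (g := fun _ => 2 ^ n * E / (wtS w n).card)]
          · rw [Finset.sum_const, nsmul_eq_mul]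
            rcases (wtS w n).card.eq_zero_or_pos with h | h
            · rw [h]; simp; positivity
            · have : (0:ℝ) < (wtS w n).card := by exact_mod_cast h
              exact (mul_div_cancel₀ _ this.ne').le
          · intro χ hχ; rw [mem_wtS.1 hχ]
      _ = _ := by simp
  unfold Aq
  have hsum := Finset.sum_le_sum (fun χ (_ : χ ∈ (univ : Finset (Fin n → ZMod 2))) => hpt χ)
  rw [Finset.sum_add_distrib, ← Finset.mul_sum] at hsum
  have hk := kap_sq_sum t n htn
  have h2n : (0:ℝ) < 2 ^ n := by positivity
  calc _ ≤ (1 / 2 ^ n) * (3 * ∑ χ, kap t n χ ^ 2 + (n + 1) * (2 ^ n * E)) := by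
        apply mul_le_mul_of_nonneg_left _ (by positivity)
        linarith
    _ = 3 * ((1 / 2 ^ n) * ∑ χ, kap t n χ ^ 2) + (n + 1) * E := by field_simp
    _ = _ := by rw [hk]; ring
lemma choose_lower {n t : ℕ} (ht8 : 8 ≤ t) (hts : 10000 * (t:ℝ) ≤ Real.sqrt n) :
    Real.sqrt n ^ t ≤ (n.choose t : ℝ) := by
  have ht8' : (8:ℝ) ≤ t := by exact_mod_cast ht8
  have hR : Real.sqrt n * Real.sqrt n = n := Real.mul_self_sqrt (Nat.cast_nonneg n)
  have hR0 : 0 ≤ Real.sqrt n := Real.sqrt_nonneg _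
  have htn : (t:ℝ) ≤ n := by nlinarith
  have htn' : t ≤ n := by exact_mod_cast htn
  have h := Nat.pow_le_choose (α := ℝ) t n
  have hf : (t.factorial : ℝ) ≤ (t:ℝ) ^ t := by exact_mod_cast Nat.factorial_le_pow t
  have hfp : (0:ℝ) < t.factorial := by exact_mod_cast Nat.factorial_pos t
  refine le_trans ?_ h
  rw [le_div_iff₀ hfp]
  have hc : ((n + 1 - t : ℕ) : ℝ) = n + 1 - t := by
    rw [Nat.cast_sub (by omega)]; push_cast; ring
  rw [hc]
  calc Real.sqrt n ^ t * t.factorial ≤ Real.sqrt n ^ t * (t:ℝ) ^ t :=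
        mul_le_mul_of_nonneg_left hf (by positivity)
    _ = (Real.sqrt n * t) ^ t := by rw [mul_pow]
    _ ≤ _ := by
      apply pow_le_pow_left₀ (by positivity)
      nlinarith

lemma ev_log (K : ℝ) : ∀ᶠ n : ℕ in atTop, K * Real.log n ^ 2 ≤ Real.sqrt n := by
  have h := isLittleO_log_rpow_rpow_atTop (s := 1/2) 2 (by norm_num)
  have h2 := (h.comp_tendsto tendsto_natCast_atTop_atTop).bound (c := 1 / (|K| + 1)) (by positivity)
  filter_upwards [h2, eventually_ge_atTop 1] with n hn h1
  have h1' : (1:ℝ) ≤ n := by exact_mod_cast h1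
  have hl : 0 ≤ Real.log n := Real.log_nonneg h1'
  simp only [Function.comp, Real.norm_eq_abs] at hn
  rw [Real.rpow_two, abs_of_nonneg (sq_nonneg _), ← Real.sqrt_eq_rpow, abs_of_nonneg (Real.sqrt_nonneg _),
    one_div, inv_mul_eq_div, le_div_iff₀ (by positivity)] at hn
  nlinarith [le_abs_self K, sq_nonneg (Real.log n)]

set_option maxHeartbeats 2000000 in
lemma final_bound (C : ℝ) (hC : 0 < C) (k n t r g : ℕ) (hr : (r:ℝ) ≤ 0.99 * n)
    (htC : (t:ℝ) ≤ C * Real.logb 2 n) (hn : 12 ≤ n)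
    (hg : (g:ℝ) ≤ 1 / (4 * C) * (t:ℝ) ^ 2 + 1)
    (ht8 : 8 ≤ t) (hts : 10000 * (t:ℝ) ≤ Real.sqrt n) (ht : (0.9995:ℝ) ^ (t - 2) ≤ 1 / 5)
    (htk : 8 * k + 12 ≤ t)
    (hlog : 4 * (C / (4 * Real.log 2) + 2 * k + 5) * Real.log n ^ 2 ≤ Real.sqrt n) :
    (1 / 2) * (r * Real.sqrt (2 ^ g * Aq t n r)) ≤ 1 / (n:ℝ) ^ k := by
  have hn' : (12:ℝ) ≤ n := by exact_mod_cast hn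
  have hnpos : (0:ℝ) < n := by linarith
  set ℓ := Real.log n with hℓ
  have hl2 : 0 < Real.log 2 := Real.log_pos (by norm_num)
  have hl1 : 1 ≤ ℓ := by
    rw [hℓ, Real.le_log_iff_exp_le hnpos]
    linarith [Real.exp_one_lt_d9]
  have hexp : Real.exp ℓ = n := Real.exp_log hnpos
  have ht8' : (8:ℝ) ≤ t := by exact_mod_cast ht8
  have htC' : t * Real.log 2 ≤ C * ℓ := by
    rw [Real.logb, ← hℓ] at htC
    calc t * Real.log 2 ≤ (C * (ℓ / Real.log 2)) * Real.log 2 := mul_le_mul_of_nonneg_right htC hl2.le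
      _ = _ := by field_simp
  -- 2^g
  have hgb : (2:ℝ) ^ g ≤ 2 * Real.exp (1 / (4 * C) * (t:ℝ) ^ 2 * Real.log 2) := by
    have e1 : (2:ℝ) ^ g = Real.exp (g * Real.log 2) := by
      rw [Real.exp_nat_mul, Real.exp_log (by norm_num)]
    have e2 : 2 * Real.exp (1 / (4 * C) * (t:ℝ) ^ 2 * Real.log 2) =
        Real.exp ((1 / (4 * C) * (t:ℝ) ^ 2 + 1) * Real.log 2) := by
      rw [add_mul, Real.exp_add, one_mul, Real.exp_log (by norm_num)]; ring
    rw [e1, e2]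
    exact Real.exp_le_exp.2 (mul_le_mul_of_nonneg_right hg hl2.le)
  have hg1 : 1 / (4 * C) * (t:ℝ) ^ 2 * Real.log 2 ≤ t * ℓ / 4 := by
    have : 1 / (4 * C) * (t:ℝ) ^ 2 * Real.log 2 = (t / (4 * C)) * (t * Real.log 2) := by ring
    rw [this]
    calc (t / (4 * C)) * (t * Real.log 2) ≤ (t / (4 * C)) * (C * ℓ) :=
          mul_le_mul_of_nonneg_left htC' (by positivity)
      _ = _ := by field_simp
  have hg2 : t * ℓ / 4 ≤ C / (4 * Real.log 2) * ℓ ^ 2 := by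
    have : (t:ℝ) ≤ C * ℓ / Real.log 2 := by rw [le_div_iff₀ hl2]; exact htC'
    calc t * ℓ / 4 ≤ (C * ℓ / Real.log 2) * ℓ / 4 := by
          apply div_le_div_of_nonneg_right _ (by norm_num)
          exact mul_le_mul_of_nonneg_right this (by linarith)
      _ = _ := by field_simp
  have hG : (2:ℝ) ^ g ≤ 2 * Real.exp (t * ℓ / 4) :=
    hgb.trans (mul_le_mul_of_nonneg_left (Real.exp_le_exp.2 hg1) (by norm_num))
  -- choose
  have hch : Real.exp (t * ℓ / 2) ≤ (n.choose t : ℝ) := by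
    have e : Real.sqrt n = Real.exp (ℓ / 2) := by
      rw [Real.exp_half, hexp]
    have := choose_lower ht8 hts
    rw [e, ← Real.exp_nat_mul] at this
    convert this using 2; ring
  have hpow : ∀ m : ℕ, (n:ℝ) ^ m = Real.exp (m * ℓ) := by
    intro m; rw [Real.exp_nat_mul, hexp]
  have htk' : 8 * (k:ℝ) + 12 ≤ t := by exact_mod_cast htk
  -- first part
  have p1 : (2:ℝ) ^ g * (3 / (n.choose t : ℝ)) ≤ (1 / 2) * (1 / (n:ℝ) ^ (2 * k + 2)) := by
    calc (2:ℝ) ^ g * (3 / (n.choose t : ℝ)) ≤ (2 * Real.exp (t * ℓ / 4)) * (3 / Real.exp (t * ℓ / 2)) := by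
          apply mul_le_mul hG _ (by positivity) (by positivity)
          exact div_le_div_of_nonneg_left (by norm_num) (Real.exp_pos _) hch
      _ = 6 * Real.exp (-(t * ℓ / 4)) := by
          rw [div_eq_mul_inv (3:ℝ), ← Real.exp_neg]
          have : Real.exp (-(t * ℓ / 4)) = Real.exp (t * ℓ / 4) * Real.exp (-(t * ℓ / 2)) := by
            rw [← Real.exp_add]; congr 1; ring
          rw [this]; ring
      _ ≤ 6 * Real.exp (-((2 * k + 3) * ℓ)) := by
          apply mul_le_mul_of_nonneg_left _ (by norm_num)
          apply Real.exp_le_exp.2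
          have h := mul_le_mul_of_nonneg_right htk' (by linarith : (0:ℝ) ≤ ℓ)
          linarith
      _ = 6 * (1 / (n:ℝ) ^ (2 * k + 3)) := by
          rw [hpow, Real.exp_neg, one_div]; push_cast; rfl
      _ ≤ _ := by
          rw [pow_succ (n:ℝ) (2 * k + 2)]
          have hq : (0:ℝ) < (n:ℝ) ^ (2 * k + 2) := by positivity
          rw [mul_one_div, mul_one_div, div_le_div_iff₀ (by positivity) hq]
          have h := mul_le_mul_of_nonneg_left hn' hq.le
          linarith
  -- second part
  have p2 : (2:ℝ) ^ g * ((n + 1) * Real.exp (- Real.sqrt n / 4)) ≤ (1 / 2) * (1 / (n:ℝ) ^ (2 * k + 2)) := by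
    have hn1 : (n:ℝ) + 1 ≤ Real.exp (2 * ℓ) := by
      have := hpow 2
      push_cast at this
      rw [← this]; clear * - hn'; nlinarith
    calc (2:ℝ) ^ g * ((n + 1) * Real.exp (- Real.sqrt n / 4)) ≤
        (2 * Real.exp (C / (4 * Real.log 2) * ℓ ^ 2)) * (Real.exp (2 * ℓ) *
          Real.exp (-((C / (4 * Real.log 2) + 2 * k + 5) * ℓ ^ 2))) := by
          apply mul_le_mul _ _ (by positivity) (by positivity)
          · exact hG.trans (mul_le_mul_of_nonneg_left (Real.exp_le_exp.2 hg2) (by norm_num))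
          · apply mul_le_mul hn1 _ (by positivity) (by positivity)
            apply Real.exp_le_exp.2
            linarith
      _ = 2 * Real.exp (2 * ℓ - (2 * k + 5) * ℓ ^ 2) := by
          rw [mul_assoc, ← Real.exp_add, ← Real.exp_add]; congr 2; ring
      _ ≤ 2 * Real.exp (-((2 * k + 3) * ℓ)) := by
          apply mul_le_mul_of_nonneg_left _ (by norm_num)
          apply Real.exp_le_exp.2
          have h0 : ℓ ≤ ℓ ^ 2 := le_self_pow₀ hl1 (by norm_num)
          have h := mul_le_mul_of_nonneg_left h0 (by positivity : (0:ℝ) ≤ 2 * k + 5)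
          linarith
      _ = 2 * (1 / (n:ℝ) ^ (2 * k + 3)) := by
          rw [hpow, Real.exp_neg, one_div]; push_cast; rfl
      _ ≤ _ := by
          rw [pow_succ (n:ℝ) (2 * k + 2)]
          have hq : (0:ℝ) < (n:ℝ) ^ (2 * k + 2) := by positivity
          rw [mul_one_div, mul_one_div, div_le_div_iff₀ (by positivity) hq]
          have h := mul_le_mul_of_nonneg_left hn' hq.le
          linarith
  have hA := mul_le_mul_of_nonneg_left (Aq_bound hr ht8 hts ht) (by positivity : (0:ℝ) ≤ 2 ^ g)
  rw [mul_add] at hA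
  have hA2 : (2:ℝ) ^ g * Aq t n r ≤ (1 / (n:ℝ) ^ (k + 1)) ^ 2 := by
    have : (1 / (n:ℝ) ^ (k + 1)) ^ 2 = 1 / (n:ℝ) ^ (2 * k + 2) := by
      rw [div_pow, one_pow, ← pow_mul]; congr 2; ring
    rw [this]; linarith
  have hs : Real.sqrt (2 ^ g * Aq t n r) ≤ 1 / (n:ℝ) ^ (k + 1) :=
    Real.sqrt_le_iff.2 ⟨by positivity, hA2⟩
  have hs0 := Real.sqrt_nonneg (2 ^ g * Aq t n r)
  have hrn : (r:ℝ) ≤ n := by linarith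
  have h1 : (r:ℝ) * Real.sqrt (2 ^ g * Aq t n r) ≤ n * (1 / (n:ℝ) ^ (k + 1)) :=
    mul_le_mul hrn hs hs0 hnpos.le
  have h2 : (n:ℝ) * (1 / (n:ℝ) ^ (k + 1)) = 1 / (n:ℝ) ^ k := by
    rw [pow_succ]; field_simp
  have h3 : 0 ≤ (r:ℝ) * Real.sqrt (2 ^ g * Aq t n r) := by positivity
  linarith

/-- Fix `C > 0` and `r, t : ℕ → ℕ` with `r n ≤ 0.99·n`,
`t n/√(log n) → ∞`, `t n ≤ C·log n`.  Then there exist `β > 0` and `g : ℕ → ℕ` with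
`g n ≥ β·(t n)²` such that the statistical distance between the marginal distribution of
`G` under `(P, G) ← LDPC[n, g n, t n, r n]` and the uniform distribution on `F₂^{n × g n}`
is negligible in `n`. -/
theorem stmt_7 (C : ℝ) (hC : 0 < C) (r t : ℕ → ℕ)
    (hr : ∀ n : ℕ, (r n : ℝ) ≤ 0.99 * n)
    (ht1 : Tendsto (fun n : ℕ => (t n : ℝ) / Real.sqrt (Real.logb 2 n)) atTop atTop)
    (ht2 : ∀ n : ℕ, (t n : ℝ) ≤ C * Real.logb 2 n) :
    ∃ β : ℝ, 0 < β ∧ ∃ g : ℕ → ℕ, (∀ n, β * (t n : ℝ) ^ 2 ≤ (g n : ℝ)) ∧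
      Negligible (fun n =>
        (1/2) * ∑ G₀ : Matrix (Fin n) (Fin (g n)) (ZMod 2),
          |margMass n (g n) (t n) (r n) G₀ -
            1 / (Fintype.card (Matrix (Fin n) (Fin (g n)) (ZMod 2)) : ℝ)|) := by
  refine ⟨1 / (4 * C), by positivity, fun n => ⌈1 / (4 * C) * (t n : ℝ) ^ 2⌉₊,
    fun n => Nat.le_ceil _, ?_⟩
  intro k
  -- `t n → ∞`
  have htT : ∀ T : ℕ, ∀ᶠ n : ℕ in atTop, T ≤ t n := by
    intro T
    filter_upwards [ht1.eventually_ge_atTop (T : ℝ), eventually_ge_atTop 2] with n h1 h2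
    have h2' : (2:ℝ) ≤ n := by exact_mod_cast h2
    have hL : 1 ≤ Real.logb 2 n := by
      rw [Real.le_logb_iff_rpow_le (by norm_num) (by linarith), Real.rpow_one]; exact h2'
    have hs : 1 ≤ Real.sqrt (Real.logb 2 n) := Real.one_le_sqrt.2 hL
    rw [le_div_iff₀ (by linarith)] at h1
    have : (T:ℝ) ≤ t n := by nlinarith [(Nat.cast_nonneg T : (0:ℝ) ≤ T)]
    exact_mod_cast this
  obtain ⟨K, hK⟩ := exists_pow_lt_of_lt_one (show (0:ℝ) < 1 / 5 by norm_num)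
    (show (0.9995:ℝ) < 1 by norm_num)
  have hev : ∀ᶠ n : ℕ in atTop, (1 / 2) * ∑ G₀ : Matrix (Fin n) (Fin ⌈1 / (4 * C) * (t n : ℝ) ^ 2⌉₊) (ZMod 2),
          |margMass n ⌈1 / (4 * C) * (t n : ℝ) ^ 2⌉₊ (t n) (r n) G₀ -
            1 / (Fintype.card (Matrix (Fin n) (Fin ⌈1 / (4 * C) * (t n : ℝ) ^ 2⌉₊) (ZMod 2)) : ℝ)| ≤
      1 / (n:ℝ) ^ k := by
    filter_upwards [htT (8 * k + 12), htT (K + 2), eventually_ge_atTop 12,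
      ev_log (4 * (C / (4 * Real.log 2) + 2 * k + 5)), ev_log (10000 * (C / Real.log 2))]
      with n h1 h2 h3 h4 h5
    have h3' : (12:ℝ) ≤ n := by exact_mod_cast h3
    have hl2 : 0 < Real.log 2 := Real.log_pos (by norm_num)
    have hl1 : 1 ≤ Real.log n := by
      rw [Real.le_log_iff_exp_le (by linarith)]
      linarith [Real.exp_one_lt_d9]
    have hts : 10000 * (t n : ℝ) ≤ Real.sqrt n := by
      refine le_trans ?_ h5
      have h6 := ht2 n
      rw [Real.logb] at h6
      have h7 : Real.log n ≤ Real.log n ^ 2 := by nlinarith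
      have h8 := mul_le_mul_of_nonneg_left h7 (by positivity : 0 ≤ C / Real.log 2)
      have h9 : C * (Real.log n / Real.log 2) = C / Real.log 2 * Real.log n := by ring
      rw [h9] at h6
      linarith
    have ht5 : (0.9995:ℝ) ^ (t n - 2) ≤ 1 / 5 :=
      (pow_le_pow_of_le_one (by norm_num) (by norm_num) (by omega)).trans hK.le
    have htn : t n ≤ n := by
      have : (t n : ℝ) ≤ n := by
        have := Real.mul_self_sqrt (Nat.cast_nonneg (α := ℝ) n)
        have h8 : (8:ℝ) ≤ t n := by exact_mod_cast (by omega : 8 ≤ t n)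
        nlinarith
      exact_mod_cast this
    have hne : (wtS (t n) n).Nonempty := by
      rw [← Finset.card_pos, card_wtS]
      exact Nat.choose_pos htn
    have hg := (Nat.ceil_lt_add_one (by positivity : 0 ≤ 1 / (4 * C) * (t n : ℝ) ^ 2)).le
    have hfin := final_bound C hC k n (t n) (r n) _ (hr n) (ht2 n) h3 hg (by omega) hts ht5 h1 h4
    have hSD := SD_le (t n) n ⌈1 / (4 * C) * (t n : ℝ) ^ 2⌉₊ (r n) hne
    linarith
  exact eventually_atTop.1 hev

end
end

section
/- Let n ≥ 1 and k ≥ 1, and let i_1, …, i_k be independent uniformly random indices in {1, …, n}. Then the probability that e_{i_1} ⊕ e_{i_2} ⊕ ⋯ ⊕ e_{i_k} = 0 in F_2^n (where e_i denotes the i-th standard basis vector) equals 2^{−n} · Σ_{s=0}^{n} C(n,s) · (1 − 2s/n)^{k}, where C(n,s) denotes the binomial coefficient n choose s. -/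
open Finset
open scoped Classical

lemma aux_sign {n k : ℕ} (f : Fin k → Fin n) (j : Fin n) (s : Finset (Fin k)) :
    (∏ i ∈ s, (if f i = j then (-1 : ℝ) else 1))
      = if (∑ i ∈ s, (Pi.single (f i) (1 : ZMod 2) : Fin n → ZMod 2) j) = 0 then 1 else -1 := by
  induction s using Finset.induction_on with
  | empty => simp
  | insert a s ha ih =>
    rw [Finset.prod_insert ha, Finset.sum_insert ha, ih]
    generalize (∑ i ∈ s, (Pi.single (f i) (1 : ZMod 2) : Fin n → ZMod 2) j) = x
    by_cases h : f a = j
    · subst h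
      simp only [Pi.single_eq_same, if_true]
      have hx : x = 0 ∨ x = 1 := by revert x; decide
      have h2 : (1 + 1 : ZMod 2) = 0 := by decide
      rcases hx with rfl | rfl <;> simp [h2]
    · simp [h]

lemma aux_char {n k : ℕ} (f : Fin k → Fin n) :
    (∑ S ∈ (univ : Finset (Fin n)).powerset, ∏ i, (if f i ∈ S then (-1 : ℝ) else 1))
      = if (∑ i, Pi.single (f i) (1 : ZMod 2)) = (0 : Fin n → ZMod 2) then 2 ^ n else 0 := by
  have h1 : ∀ S : Finset (Fin n), (∏ i, (if f i ∈ S then (-1 : ℝ) else 1))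
      = ∏ j ∈ S, ∏ i, (if f i = j then (-1 : ℝ) else 1) := by
    intro S
    rw [Finset.prod_comm]
    refine Finset.prod_congr rfl fun i _ => ?_
    rw [Finset.prod_ite_eq]
  simp_rw [h1]
  rw [← Finset.prod_one_add]
  simp_rw [aux_sign]
  split_ifs with h
  · have h' : ∀ j, ∑ i, (Pi.single (f i) (1 : ZMod 2) : Fin n → ZMod 2) j = 0 := by
      intro j
      have := congrFun h j
      simpa [Finset.sum_apply] using this
    simp only [h', if_true]
    norm_num
  · obtain ⟨j, hj⟩ := Function.ne_iff.mp h
    rw [Finset.sum_apply, Pi.zero_apply] at hj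
    refine Finset.prod_eq_zero (Finset.mem_univ j) ?_
    rw [if_neg hj]
    norm_num

lemma aux_eig {n : ℕ} (S : Finset (Fin n)) :
    (∑ a, (if a ∈ S then (-1 : ℝ) else 1)) = n - 2 * S.card := by
  have : ∀ a, (if a ∈ S then (-1 : ℝ) else 1) = 1 - 2 * (if a ∈ S then 1 else 0) := by
    intro a; split_ifs <;> norm_num
  simp_rw [this]
  rw [Finset.sum_sub_distrib, ← Finset.mul_sum]
  simp

/-- Let `n, k ≥ 1` and let `i₁, …, i_k` be independent uniform indices in
`{1, …, n}`.  The probability that `e_{i₁} ⊕ ⋯ ⊕ e_{i_k} = 0` in `F₂ⁿ` equals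
`2^{−n} · Σ_{s=0}^{n} C(n,s)·(1 − 2s/n)^k`. -/
theorem stmt_8 (n k : ℕ) (hn : 1 ≤ n) (hk : 1 ≤ k) :
    ((univ.filter (fun f : Fin k → Fin n =>
        (∑ i, Pi.single (f i) (1 : ZMod 2)) = (0 : Fin n → ZMod 2))).card : ℝ) / (n : ℝ) ^ k
    = (1 / 2 ^ n) * ∑ s ∈ Finset.range (n + 1),
        (n.choose s : ℝ) * (1 - 2 * (s : ℝ) / n) ^ k := by
  have hn0 : (n : ℝ) ≠ 0 := by positivity
  have key : (2 : ℝ) ^ n * ((univ.filter (fun f : Fin k → Fin n =>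
        (∑ i, Pi.single (f i) (1 : ZMod 2)) = (0 : Fin n → ZMod 2))).card : ℝ)
      = ∑ s ∈ Finset.range (n + 1), (n.choose s : ℝ) * ((n : ℝ) - 2 * s) ^ k := by
    have h1 := Finset.sum_powerset_apply_card (fun s : ℕ => ((n : ℝ) - 2 * s) ^ k)
      (x := (univ : Finset (Fin n)))
    simp only [Finset.card_univ, Fintype.card_fin, nsmul_eq_mul] at h1
    rw [← h1]
    have h2 : ∀ S : Finset (Fin n), ((n : ℝ) - 2 * S.card) ^ k
        = ∑ f : Fin k → Fin n, ∏ i, (if f i ∈ S then (-1 : ℝ) else 1) := by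
      intro S
      rw [← aux_eig, Fintype.sum_pow]
    simp_rw [h2]
    rw [Finset.sum_comm]
    simp_rw [aux_char]
    rw [← Finset.sum_filter, Finset.sum_const, nsmul_eq_mul, mul_comm]
  have h3 : ∀ s : ℕ, (n.choose s : ℝ) * (1 - 2 * (s : ℝ) / n) ^ k
      = (n.choose s : ℝ) * ((n : ℝ) - 2 * s) ^ k / (n : ℝ) ^ k := by
    intro s
    rw [mul_div_assoc (n.choose s : ℝ) (((n : ℝ) - 2 * s) ^ k), ← div_pow, sub_div, div_self hn0]
  simp_rw [h3]
  rw [← Finset.sum_div, ← key]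
  field_simp
end

section
/- Let 1 ≤ t ≤ n and ℓ ≥ 1, and let w_1, …, w_ℓ be independent uniformly random elements of S_{t,n}. Then Pr[w_1 ⊕ w_2 ⊕ ⋯ ⊕ w_ℓ = 0] ≤ (n^t / (n·(n−1)⋯(n−t+1)))^ℓ · 2^{−n} · Σ_{s=0}^{n} C(n,s) · (1 − 2s/n)^{ℓ·t}, where C(n,s) denotes the binomial coefficient n choose s. -/
open Finset
open scoped Classical

/-- sign character of `ZMod 2` -/
noncomputable def sgnChar (a : ZMod 2) : ℝ := if a = 0 then 1 else -1

lemma sgnChar_add (a b : ZMod 2) : sgnChar (a + b) = sgnChar a * sgnChar b := by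
  have h2 : (1 : ZMod 2) + 1 = 0 := by decide
  have hz : ∀ a : ZMod 2, a = 0 ∨ a = 1 := by decide
  rcases hz a with rfl | rfl <;> rcases hz b with rfl | rfl <;> simp [sgnChar, h2]

lemma sgnChar_sum {K : Type*} (s : Finset K) (x : K → ZMod 2) :
    sgnChar (∑ k ∈ s, x k) = ∏ k ∈ s, sgnChar (x k) := by
  induction s using Finset.induction_on with
  | empty => simp [sgnChar]
  | insert a s ha ih => rw [Finset.sum_insert ha, Finset.prod_insert ha, sgnChar_add, ih]

lemma indicator_sum (n : ℕ) (v : Fin n → ZMod 2) :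
    ∑ S ∈ (univ : Finset (Fin n)).powerset, ∏ i ∈ S, sgnChar (v i)
      = if v = 0 then (2 : ℝ) ^ n else 0 := by
  rw [← Finset.prod_one_add]
  split_ifs with h
  · subst h
    simp [sgnChar]
    norm_num
  · obtain ⟨i, hi⟩ := Function.ne_iff.mp h
    apply Finset.prod_eq_zero (Finset.mem_univ i)
    have : v i ≠ 0 := hi
    simp [sgnChar, this]

lemma char_single (n : ℕ) (S : Finset (Fin n)) (j : Fin n) :
    ∏ i ∈ S, sgnChar ((Pi.single j 1 : Fin n → ZMod 2) i) = if j ∈ S then (-1 : ℝ) else 1 := by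
  have : ∀ i, sgnChar ((Pi.single j 1 : Fin n → ZMod 2) i) = if i = j then (-1 : ℝ) else 1 := by
    intro i
    by_cases h : i = j
    · subst h; simp [sgnChar]
    · simp [sgnChar, h]
  simp only [this]
  rw [Finset.prod_ite_eq']

lemma sum_char (n : ℕ) (S : Finset (Fin n)) :
    ∑ j : Fin n, (if j ∈ S then (-1 : ℝ) else 1) = n - 2 * S.card := by
  have : ∀ j : Fin n, (if j ∈ S then (-1 : ℝ) else 1) = 1 - 2 * (if j ∈ S then 1 else 0) := by
    intro j; split_ifs <;> norm_num
  simp only [this]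
  rw [Finset.sum_sub_distrib, ← Finset.mul_sum]
  simp

lemma count_walks (n : ℕ) (K : Type) [Fintype K] [DecidableEq K] :
    (2 : ℝ) ^ n * ((univ.filter (fun f : K → Fin n =>
        ∑ k, (Pi.single (f k) 1 : Fin n → ZMod 2) = 0)).card : ℝ)
      = ∑ s ∈ Finset.range (n + 1), (n.choose s : ℝ) * (n - 2 * (s : ℝ)) ^ (Fintype.card K) := by
  have h1 : (2 : ℝ) ^ n * ((univ.filter (fun f : K → Fin n =>
        ∑ k, (Pi.single (f k) 1 : Fin n → ZMod 2) = 0)).card : ℝ)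
      = ∑ f : K → Fin n, ∑ S ∈ (univ : Finset (Fin n)).powerset,
          ∏ k, (if f k ∈ S then (-1 : ℝ) else 1) := by
    rw [Finset.card_filter, Nat.cast_sum, Finset.mul_sum]
    apply Finset.sum_congr rfl
    intro f _
    have := indicator_sum n (∑ k, (Pi.single (f k) 1 : Fin n → ZMod 2))
    have h3 : ∀ S : Finset (Fin n), ∏ i ∈ S,
        sgnChar ((∑ k, (Pi.single (f k) 1 : Fin n → ZMod 2)) i)
        = ∏ k, (if f k ∈ S then (-1 : ℝ) else 1) := by
      intro S
      simp only [Finset.sum_apply, sgnChar_sum]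
      rw [Finset.prod_comm]
      simp only [char_single]
    simp only [h3] at this
    rw [this]
    split_ifs <;> simp
  rw [h1, Finset.sum_comm]
  have h2 : ∀ S : Finset (Fin n), ∑ f : K → Fin n, ∏ k, (if f k ∈ S then (-1 : ℝ) else 1)
      = (n - 2 * (S.card : ℝ)) ^ (Fintype.card K) := by
    intro S
    rw [← sum_char, ← Fintype.piFinset_univ,
      ← Finset.prod_univ_sum (fun _ : K => (univ : Finset (Fin n)))
        (fun _ j => if j ∈ S then (-1 : ℝ) else 1)]
    simp
  simp only [h2]
  rw [Finset.sum_powerset_apply_card (fun m => ((n : ℝ) - 2 * (m : ℝ)) ^ (Fintype.card K))]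
  simp

lemma exists_enum (n t : ℕ) (v : Fin n → ZMod 2) (hv : hammingNorm v = t) :
    ∃ e : Fin t → Fin n, Function.Injective e ∧
      ∑ j, (Pi.single (e j) 1 : Fin n → ZMod 2) = v := by
  let s : Finset (Fin n) := univ.filter (fun i => v i ≠ 0)
  have hs : s.card = t := by
    rw [← hv]; unfold hammingNorm; simp only [s]
  refine ⟨s.orderEmbOfFin hs, (s.orderEmbOfFin hs).injective, ?_⟩
  have h1 : ∑ j, (Pi.single (s.orderEmbOfFin hs j) 1 : Fin n → ZMod 2)
      = ∑ i ∈ s, (Pi.single i 1 : Fin n → ZMod 2) := by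
    conv_rhs => rw [← Finset.image_orderEmbOfFin_univ s hs]
    rw [Finset.sum_image]
    intro a _ b _ h
    exact (s.orderEmbOfFin hs).injective h
  rw [h1]
  ext i
  simp only [Finset.sum_apply, Pi.single_apply]
  rw [Finset.sum_ite_eq]
  have hz : ∀ a : ZMod 2, a ≠ 0 → a = 1 := by decide
  by_cases h : v i = 0
  · simp [s, h]
  · simp [s, hz _ h]

lemma count_le (n t l : ℕ) :
    (univ.filter (fun w : Fin l → (Fin n → ZMod 2) =>
        (∀ i, hammingNorm (w i) = t) ∧ (∑ i, w i) = 0)).card * t.factorial ^ l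
    ≤ (univ.filter (fun f : Fin l × Fin t → Fin n =>
        ∑ k, (Pi.single (f k) 1 : Fin n → ZMod 2) = 0)).card := by
  rcases isEmpty_or_nonempty (Fin t → Fin n) with he | he
  · have : (univ.filter (fun w : Fin l → (Fin n → ZMod 2) =>
        (∀ i, hammingNorm (w i) = t) ∧ (∑ i, w i) = 0)).card = 0 ∨ l = 0 := by
      by_cases hl : l = 0
      · exact Or.inr hl
      left
      rw [Finset.card_eq_zero, Finset.filter_eq_empty_iff]
      rintro w - ⟨hw, -⟩
      obtain ⟨e, -⟩ := exists_enum n t (w ⟨0, by omega⟩) (hw _)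
      exact he.elim e
    rcases this with h | h
    · simp [h]
    · subst h
      simp
  have hch : ∀ v : Fin n → ZMod 2, ∃ e : Fin t → Fin n, hammingNorm v = t →
      (Function.Injective e ∧ ∑ j, (Pi.single (e j) 1 : Fin n → ZMod 2) = v) := by
    intro v
    by_cases hv : hammingNorm v = t
    · obtain ⟨e, h⟩ := exists_enum n t v hv
      exact ⟨e, fun _ => h⟩
    · exact ⟨Classical.arbitrary _, fun h => absurd h hv⟩
  choose en hen using hch
  have hc : t.factorial ^ l = (univ : Finset (Fin l → Equiv.Perm (Fin t))).card := by
    simp [Fintype.card_perm]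
  rw [hc, ← Finset.card_product]
  have hsum : ∀ (v : Fin n → ZMod 2) (σ : Equiv.Perm (Fin t)), hammingNorm v = t →
      ∑ j, (Pi.single (en v (σ j)) 1 : Fin n → ZMod 2) = v := by
    intro v σ hv
    rw [Equiv.sum_comp σ (fun j => (Pi.single (en v j) 1 : Fin n → ZMod 2))]
    exact (hen v hv).2
  apply Finset.card_le_card_of_injOn
    (fun p : (Fin l → (Fin n → ZMod 2)) × (Fin l → Equiv.Perm (Fin t)) =>
      fun k : Fin l × Fin t => en (p.1 k.1) (p.2 k.1 k.2))
  · rintro ⟨w, σ⟩ hp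
    simp only [Finset.coe_product, Set.mem_prod, Finset.mem_coe, Finset.mem_filter,
      Finset.mem_univ, true_and, and_true] at hp
    simp only [Finset.coe_filter, Set.mem_ofPred_eq, Finset.mem_univ, true_and]
    rw [Fintype.sum_prod_type]
    simp only [fun i => hsum (w i) (σ i) (hp.1 i)]
    exact hp.2
  · rintro ⟨w, σ⟩ hp ⟨w', σ'⟩ hp' heq
    simp only [Finset.coe_product, Set.mem_prod, Finset.mem_coe, Finset.mem_filter,
      Finset.mem_univ, true_and, and_true] at hp hp'
    have heq' : ∀ i j, en (w i) (σ i j) = en (w' i) (σ' i j) := fun i j => congrFun heq (i, j)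
    have hw : w = w' := by
      funext i
      rw [← hsum (w i) (σ i) (hp.1 i), ← hsum (w' i) (σ' i) (hp'.1 i)]
      simp only [heq']
    subst hw
    have hσ : σ = σ' := by
      funext i
      ext j
      rw [(hen (w i) (hp.1 i)).1 (heq' i j)]
    rw [hσ]

lemma card_sphere (n t : ℕ) :
    (univ.filter (fun v : Fin n → ZMod 2 => hammingNorm v = t)).card = n.choose t := by
  have h : (Finset.powersetCard t (univ : Finset (Fin n))).card = n.choose t := by simp
  rw [← h]
  have hz : ∀ a : ZMod 2, a ≠ 0 → a = 1 := by decide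
  refine Finset.card_bij (fun v _ => univ.filter (fun i => v i ≠ 0)) ?_ ?_ ?_
  · intro v hv
    simp only [Finset.mem_filter, Finset.mem_univ, true_and] at hv
    rw [Finset.mem_powersetCard]
    refine ⟨Finset.subset_univ _, ?_⟩
    rw [← hv]; unfold hammingNorm; congr
  · intro v _ v' _ h
    ext i
    have := Finset.ext_iff.mp h i
    simp only [Finset.mem_filter, Finset.mem_univ, true_and] at this
    by_cases h1 : v i = 0
    · have h2 : v' i = 0 := by tauto
      rw [h1, h2]
    · rw [hz _ h1, hz _ (this.mp h1)]
  · intro S hS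
    rw [Finset.mem_powersetCard] at hS
    have hS' : univ.filter (fun i => (if i ∈ S then (1 : ZMod 2) else 0) ≠ 0) = S := by
      ext i; simp
    refine ⟨fun i => if i ∈ S then 1 else 0, ?_, hS'⟩
    simp only [Finset.mem_filter, Finset.mem_univ, true_and]
    rw [← hS.2]
    conv_rhs => rw [← hS']
    unfold hammingNorm; congr

/-- Let `1 ≤ t ≤ n` and `ℓ ≥ 1`, and let `w₁, …, w_ℓ` be independent
uniform elements of the set `S_{t,n}` of weight-`t` vectors in `F₂ⁿ`.  Then
`Pr[w₁ ⊕ ⋯ ⊕ w_ℓ = 0] ≤ (nᵗ/(n·(n−1)⋯(n−t+1)))^ℓ · 2^{−n} Σ_{s=0}^{n} C(n,s)(1 − 2s/n)^{ℓt}`. -/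
theorem stmt_9 (n t l : ℕ) (ht1 : 1 ≤ t) (htn : t ≤ n) (hl : 1 ≤ l) :
    ((univ.filter (fun w : Fin l → (Fin n → ZMod 2) =>
        (∀ i, hammingNorm (w i) = t) ∧ (∑ i, w i) = 0)).card : ℝ) /
      (((univ.filter (fun v : Fin n → ZMod 2 => hammingNorm v = t)).card : ℝ)) ^ l
    ≤ ((n : ℝ) ^ t / (n.descFactorial t : ℝ)) ^ l *
        ((1 / 2 ^ n) * ∑ s ∈ Finset.range (n + 1),
          (n.choose s : ℝ) * (1 - 2 * (s : ℝ) / n) ^ (l * t)) := by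
  rw [card_sphere]
  have hn : (n : ℝ) ≠ 0 := by
    have : n ≠ 0 := by omega
    exact_mod_cast this
  have hd : (n.descFactorial t : ℝ) = t.factorial * n.choose t := by
    exact_mod_cast Nat.descFactorial_eq_factorial_mul_choose n t
  have hcp : (0 : ℝ) < n.choose t := by exact_mod_cast Nat.choose_pos htn
  have hfp : (0 : ℝ) < t.factorial := by exact_mod_cast Nat.factorial_pos t
  have hw := count_walks n (Fin l × Fin t)
  have hle : ((univ.filter (fun w : Fin l → (Fin n → ZMod 2) =>
        (∀ i, hammingNorm (w i) = t) ∧ (∑ i, w i) = 0)).card : ℝ) * (t.factorial : ℝ) ^ l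
    ≤ ((univ.filter (fun f : Fin l × Fin t → Fin n =>
        ∑ k, (Pi.single (f k) 1 : Fin n → ZMod 2) = 0)).card : ℝ) := by
    exact_mod_cast count_le n t l
  have hs : ∑ s ∈ Finset.range (n + 1), (n.choose s : ℝ) * (n - 2 * (s : ℝ)) ^ (l * t)
      = (n : ℝ) ^ (l * t) * ∑ s ∈ Finset.range (n + 1),
          (n.choose s : ℝ) * (1 - 2 * (s : ℝ) / n) ^ (l * t) := by
    rw [Finset.mul_sum]
    apply Finset.sum_congr rfl
    intro s _
    have : (n : ℝ) - 2 * s = n * (1 - 2 * (s : ℝ) / n) := by field_simp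
    rw [this, mul_pow]; ring
  simp only [Fintype.card_prod, Fintype.card_fin] at hw
  rw [hs] at hw
  generalize ∑ s ∈ Finset.range (n + 1),
          (n.choose s : ℝ) * (1 - 2 * (s : ℝ) / n) ^ (l * t) = Q at *
  generalize ((univ.filter (fun f : Fin l × Fin t → Fin n =>
        ∑ k, (Pi.single (f k) 1 : Fin n → ZMod 2) = 0)).card : ℝ) = N at *
  have hN : ((n : ℝ) ^ t / (n.descFactorial t : ℝ)) ^ l * ((1 / 2 ^ n) * Q)
      = N / ((t.factorial : ℝ) ^ l * (n.choose t : ℝ) ^ l) := by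
    rw [hd, div_pow, ← pow_mul, mul_comm t l, mul_pow]
    have h2 : (2 : ℝ) ^ n ≠ 0 := by positivity
    rw [div_mul_eq_mul_div]
    congr 1
    field_simp
    linarith
  rw [hN, div_le_div_iff₀ (by positivity) (by positivity)]
  have hp : (0 : ℝ) ≤ (n.choose t : ℝ) ^ l := by positivity
  have := mul_le_mul_of_nonneg_right hle hp
  rw [← mul_assoc]
  exact this
end
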